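/- For any bounded open set Ω ⊂ ℝ² with |Ω| > 0 and T(Ω) > 0 and any q > 0, the identity F_q(Ω) = F_{1/2}(Ω) · (T(Ω)/|Ω|²)^{q − 1/2} holds, where F_q(Ω) = P(Ω) T(Ω)^q |Ω|^{-(2q+1/2)}. Consequently, combining the Saint-Venant inequality T(Ω)/|Ω|² ≤ T(B)/|B|² = 1/(8π) with the bound F_{1/2}(Ω) ≥ 3^{-1/2} P(Ω)/(2𝓗¹(∂Ω) + (k−2)P(Ω)) for Ω ∈ 𝒜ₖ with k > 1, one gets for Lipschitz Ω ∈ 𝒜ₖ and q ≤ 1/2: F_q(Ω) ≥ (8π)^{1/2−q} (3^{1/2} k)^{-1}. -/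

import Mathlib

open MeasureTheory Metric Set Filter Topology Bornology ENNReal

noncomputable section

abbrev E2 := EuclideanSpace ℝ (Fin 2)

/-- divergence of a vector field on ℝ² -/
def divg (φ : E2 → E2) (x : E2) : ℝ := ∑ i, fderiv ℝ φ x (EuclideanSpace.single i 1) i

/-- the set of admissible values in De Giorgi's definition of perimeter -/
def perimSet (Ω : Set E2) : Set ℝ :=
  {r | ∃ φ : E2 → E2, ContDiff ℝ 1 φ ∧ HasCompactSupport φ ∧ (∀ x, ‖φ x‖ ≤ 1) ∧
        r = ∫ x in Ω, divg φ x}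

/-- De Giorgi perimeter -/
def perimeter (Ω : Set E2) : ℝ := sSup (perimSet Ω)

def HasFinitePerimeter (Ω : Set E2) : Prop := BddAbove (perimSet Ω)

/-- torsional rigidity via the variational formula -/
def torsion (Ω : Set E2) : ℝ :=
  sSup ({0} ∪ {r | ∃ u : E2 → ℝ, ContDiff ℝ 1 u ∧ HasCompactSupport u ∧ tsupport u ⊆ Ω ∧
      (∫ x in Ω, ‖fderiv ℝ u x‖ ^ 2) ≠ 0 ∧
      r = (∫ x in Ω, u x) ^ 2 / ∫ x in Ω, ‖fderiv ℝ u x‖ ^ 2})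

def inradius (Ω : Set E2) : ℝ := sSup ((fun x => infDist x (frontier Ω)) '' Ω)

def innerParallel (Ω : Set E2) (t : ℝ) : Set E2 := {x ∈ Ω | t < infDist x (frontier Ω)}

def boundedComponents (s : Set E2) : Set (Set E2) :=
  {C | ∃ x ∈ s, C = connectedComponentIn s x ∧ IsBounded C}

/-- `s` has at most `k` bounded connected components -/
def nBddCompLe (s : Set E2) (k : ℕ) : Prop :=
  (boundedComponents s).Finite ∧ (boundedComponents s).ncard ≤ k

/-- the class 𝒜ₖ -/
def memA (k : ℕ) (Ω : Set E2) : Prop :=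
  Ω.Nonempty ∧ IsOpen Ω ∧ IsBounded Ω ∧ nBddCompLe Ωᶜ k

/-- points of density `t` of `s` -/
def densityPts (s : Set E2) (t : ℝ≥0∞) : Set E2 :=
  {x | Tendsto (fun r => volume (s ∩ ball x r) / volume (ball x r)) (𝓝[>] (0:ℝ)) (𝓝 t)}

/-- area of the interior parallel set -/
def Afun (Ω : Set E2) (t : ℝ) : ℝ := (volume (innerParallel Ω t)).toReal

/-- length of the interior parallel -/
def Lfun (Ω : Set E2) (t : ℝ) : ℝ :=
  (μH[1] ({x ∈ Ω | infDist x (frontier Ω) = t})).toReal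

/-- a bounded open set with Lipschitz boundary -/
def IsLipschitzDomain (Ω : Set E2) : Prop :=
  ∀ x ∈ frontier Ω, ∃ (g : E2 ≃ₗᵢ[ℝ] E2) (f : ℝ → ℝ) (K : NNReal) (ε : ℝ),
    0 < ε ∧ LipschitzWith K f ∧
    Ω ∩ ball x ε = {y ∈ ball x ε | f ((g (y - x)) 0) < (g (y - x)) 1}

/-- the scale-free shape functional F_q -/
def Fq (q : ℝ) (Ω : Set E2) : ℝ :=
  perimeter Ω * torsion Ω ^ q / (volume Ω).toReal ^ (2 * q + 1 / 2)

end
/-! ### Combinatorics of finite sets of grid cells -/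

def stepH (D : Finset (ℤ × ℤ)) : Finset (ℤ × ℤ) := D ∪ D.image (fun z => (z.1 + 1, z.2))
def stepV (D : Finset (ℤ × ℤ)) : Finset (ℤ × ℤ) := D ∪ D.image (fun z => (z.1, z.2 + 1))

lemma mem_stepH {D : Finset (ℤ × ℤ)} {z : ℤ × ℤ} :
    z ∈ stepH D ↔ z ∈ D ∨ (z.1 - 1, z.2) ∈ D := by
  unfold stepH
  simp only [Finset.mem_union, Finset.mem_image, Prod.exists]
  constructor
  · rintro (h | ⟨a, b, h, rfl⟩)
    · exact Or.inl h
    · right; simpa using h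
  · rintro (h | h)
    · exact Or.inl h
    · right; exact ⟨_, _, h, by ext <;> simp⟩

lemma mem_stepV {D : Finset (ℤ × ℤ)} {z : ℤ × ℤ} :
    z ∈ stepV D ↔ z ∈ D ∨ (z.1, z.2 - 1) ∈ D := by
  unfold stepV
  simp only [Finset.mem_union, Finset.mem_image, Prod.exists]
  constructor
  · rintro (h | ⟨a, b, h, rfl⟩)
    · exact Or.inl h
    · right; simpa using h
  · rintro (h | h)
    · exact Or.inl h
    · right; exact ⟨_, _, h, by ext <;> simp⟩

def cellRel (D : Finset (ℤ × ℤ)) (z w : ℤ × ℤ) : Prop :=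
  z ∈ D ∧ w ∈ D ∧ |z.1 - w.1| ≤ 1 ∧ |z.2 - w.2| ≤ 1

def HasReps (D : Finset (ℤ × ℤ)) (c : ℕ) : Prop :=
  ∃ R : Finset (ℤ × ℤ), R ⊆ D ∧ R.card ≤ c ∧
    ∀ z ∈ D, ∃ ρ ∈ R, Relation.ReflTransGen (cellRel D) ρ z

lemma cellRel_mono {D D' : Finset (ℤ × ℤ)} (h : D ⊆ D') {z w : ℤ × ℤ} (hr : cellRel D z w) :
    cellRel D' z w := ⟨h hr.1, h hr.2.1, hr.2.2⟩

lemma subset_stepH (D : Finset (ℤ × ℤ)) : D ⊆ stepH D := fun _ h => mem_stepH.2 (Or.inl h)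
lemma subset_stepV (D : Finset (ℤ × ℤ)) : D ⊆ stepV D := fun _ h => mem_stepV.2 (Or.inl h)

lemma HasReps.stepH {D : Finset (ℤ × ℤ)} {c : ℕ} (h : HasReps D c) : HasReps (stepH D) c := by
  obtain ⟨R, hR, hc, hz⟩ := h
  refine ⟨R, hR.trans (subset_stepH D), hc, fun z hzD => ?_⟩
  rcases mem_stepH.1 hzD with h1 | h1
  · obtain ⟨ρ, hρ, hp⟩ := hz z h1
    exact ⟨ρ, hρ, Relation.ReflTransGen.mono (fun _ _ => cellRel_mono (subset_stepH D)) _ _ hp⟩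
  · obtain ⟨ρ, hρ, hp⟩ := hz _ h1
    refine ⟨ρ, hρ, (Relation.ReflTransGen.mono (fun _ _ => cellRel_mono (subset_stepH D)) _ _ hp).tail ?_⟩
    exact ⟨subset_stepH D h1, hzD, by simp, by simp⟩

lemma HasReps.stepV {D : Finset (ℤ × ℤ)} {c : ℕ} (h : HasReps D c) : HasReps (stepV D) c := by
  obtain ⟨R, hR, hc, hz⟩ := h
  refine ⟨R, hR.trans (subset_stepV D), hc, fun z hzD => ?_⟩
  rcases mem_stepV.1 hzD with h1 | h1
  · obtain ⟨ρ, hρ, hp⟩ := hz z h1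
    exact ⟨ρ, hρ, Relation.ReflTransGen.mono (fun _ _ => cellRel_mono (subset_stepV D)) _ _ hp⟩
  · obtain ⟨ρ, hρ, hp⟩ := hz _ h1
    refine ⟨ρ, hρ, (Relation.ReflTransGen.mono (fun _ _ => cellRel_mono (subset_stepV D)) _ _ hp).tail ?_⟩
    exact ⟨subset_stepV D h1, hzD, by simp, by simp⟩

/-- extension by zero, as a linear map -/
noncomputable def extZ (V : Finset (ℤ × ℤ)) : (V → ℝ) →ₗ[ℝ] (ℤ × ℤ → ℝ) where
  toFun f z := if h : z ∈ V then f ⟨z, h⟩ else 0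
  map_add' f g := by ext z; by_cases h : z ∈ V <;> simp [h]
  map_smul' c f := by ext z; by_cases h : z ∈ V <;> simp [h]

lemma euler_aux {D R : Finset (ℤ × ℤ)} (hR : ∀ z ∈ D, ∃ ρ ∈ R, Relation.ReflTransGen (cellRel D) ρ z)
    (g : ℤ × ℤ → ℝ) (h1 : ∀ z ∈ stepV D, g z = g (z.1 + 1, z.2))
    (h2 : ∀ z ∈ stepH D, z ∉ D → g z = g (z.1, z.2 + 1)) (h3 : ∀ z ∈ R, g z = 0) :
    ∀ z ∈ stepV (stepH D), g z = 0 := by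
  -- vertical edges
  have hb : ∃ M : ℤ, ∀ z ∈ D, z.1 < M := by
    obtain ⟨M, hM⟩ := (D.image Prod.fst).bddAbove
    exact ⟨M + 1, fun z hz => Int.lt_add_one_iff.2 (hM (by simpa using ⟨z.2, hz⟩))⟩
  obtain ⟨M, hM⟩ := hb
  have hv : ∀ n : ℕ, ∀ z ∈ stepH D, M - n ≤ z.1 → g z = g (z.1, z.2 + 1) := by
    intro n
    induction n with
    | zero =>
      intro z hz hm
      refine h2 z hz fun hD => ?_
      have := hM z hD
      simp at hm; omega
    | succ n ih =>
      intro z hz hm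
      by_cases hD : z ∈ D
      · have e1 := h1 z (subset_stepV D hD)
        have e2 := h1 (z.1, z.2 + 1) (mem_stepV.2 (Or.inr (by simpa using hD)))
        have e3 := ih (z.1 + 1, z.2) (mem_stepH.2 (Or.inr (by simpa using hD)))
          (by push_cast at hm; simp only; omega)
        simp only at e2 e3
        rw [e1, e2, e3]
      · exact h2 z hz hD
  have hv' : ∀ z ∈ stepH D, g z = g (z.1, z.2 + 1) := fun z hz =>
    hv (M - z.1).toNat z hz (by have := Int.self_le_toNat (M - z.1); omega)
  -- corners of a cell
  have hc : ∀ z ∈ D, ∀ i j : ℤ, (i = 0 ∨ i = 1) → (j = 0 ∨ j = 1) → g (z.1 + i, z.2 + j) = g z := by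
    intro z hz i j hi hj
    have e1 := h1 z (subset_stepV D hz)
    have e2 := hv' z (subset_stepH D hz)
    have e3 := h1 (z.1, z.2 + 1) (mem_stepV.2 (Or.inr (by simpa using hz)))
    simp only at e3
    rcases hi with rfl | rfl <;> rcases hj with rfl | rfl <;> simp [← e1, ← e2, ← e3]
  have hadj : ∀ z w, cellRel D z w → g z = g w := by
    rintro ⟨a, b⟩ ⟨a', b'⟩ ⟨hz, hw, ha, hb⟩
    simp only at ha hb
    rw [abs_le] at ha hb
    have k1 := hc _ hz (max a a' - a) (max b b' - b) (by omega) (by omega)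
    have k2 := hc _ hw (max a a' - a') (max b b' - b') (by omega) (by omega)
    simp only [add_sub_cancel] at k1 k2
    rw [← k1, ← k2]
  have hD0 : ∀ z ∈ D, g z = 0 := by
    intro z hz
    obtain ⟨ρ, hρ, hp⟩ := hR z hz
    have : g ρ = g z := by
      induction hp with
      | refl => rfl
      | tail h1 h2 ih => rw [ih h2.1]; exact hadj _ _ h2
    rw [← this]; exact h3 ρ hρ
  intro z hz
  rcases mem_stepV.1 hz with h | h <;> rcases mem_stepH.1 h with h | h
  · exact hD0 z h
  · have := hc _ h 1 0 (by simp) (by simp)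
    simp only [sub_add_cancel, add_zero] at this
    rw [this]; exact hD0 _ h
  · have := hc _ h 0 1 (by simp) (by simp)
    simp only [sub_add_cancel, add_zero] at this
    rw [this]; exact hD0 _ h
  · have := hc _ h 1 1 (by simp) (by simp)
    simp only [sub_add_cancel] at this
    rw [this]; exact hD0 _ h

lemma euler_le {D : Finset (ℤ × ℤ)} {c : ℕ} (h : HasReps D c) :
    (stepV (stepH D)).card + D.card ≤ (stepH D).card + (stepV D).card + c := by
  obtain ⟨R, hRD, hRc, hR⟩ := h
  set V := stepV (stepH D) with hV
  let E := extZ V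
  let L1 : (V → ℝ) →ₗ[ℝ] (stepV D → ℝ) :=
    LinearMap.pi fun z => (LinearMap.proj (R := ℝ) (φ := fun _ : ℤ × ℤ => ℝ) (z : ℤ × ℤ) - LinearMap.proj ((z : ℤ × ℤ).1 + 1, (z : ℤ × ℤ).2)) ∘ₗ E
  let L2 : (V → ℝ) →ₗ[ℝ] ((stepH D \ D : Finset (ℤ × ℤ)) → ℝ) :=
    LinearMap.pi fun z => (LinearMap.proj (R := ℝ) (φ := fun _ : ℤ × ℤ => ℝ) (z : ℤ × ℤ) - LinearMap.proj ((z : ℤ × ℤ).1, (z : ℤ × ℤ).2 + 1)) ∘ₗ E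
  let L3 : (V → ℝ) →ₗ[ℝ] (R → ℝ) := LinearMap.pi fun z => (LinearMap.proj (R := ℝ) (φ := fun _ : ℤ × ℤ => ℝ) (z : ℤ × ℤ)) ∘ₗ E
  have hinj : Function.Injective (L1.prod (L2.prod L3)) := by
    rw [← LinearMap.ker_eq_bot, LinearMap.ker_eq_bot']
    intro f hf
    have f1 : L1 f = 0 := congrArg Prod.fst hf
    have f2 : L2 f = 0 := congrArg (fun p => p.2.1) hf
    have f3 : L3 f = 0 := congrArg (fun p => p.2.2) hf
    have key := euler_aux hR (E f)
      (fun z hz => by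
        have := congrFun f1 ⟨z, hz⟩
        simpa [L1, sub_eq_zero] using this)
      (fun z hz hz' => by
        have := congrFun f2 ⟨z, Finset.mem_sdiff.2 ⟨hz, hz'⟩⟩
        simpa [L2, sub_eq_zero] using this)
      (fun z hz => by
        have := congrFun f3 ⟨z, hz⟩
        simpa [L3] using this)
    ext ⟨z, hz⟩
    have := key z hz
    simpa [E, extZ, hV ▸ hz, hz] using this
  have := LinearMap.finrank_le_finrank_of_injective hinj
  simp only [Module.finrank_prod, Module.finrank_fintype_fun_eq_card, Fintype.card_coe] at this
  rw [Finset.card_sdiff_of_subset (subset_stepH D)] at this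
  have := Finset.card_le_card (subset_stepH D)
  omega

lemma stepH_concave (D : Finset (ℤ × ℤ)) :
    (stepH (stepH D)).card + D.card ≤ 2 * (stepH D).card := by
  have h : (stepH (stepH D) \ stepH D).card ≤ (stepH D \ D).card := by
    refine Finset.card_le_card_of_injOn (fun z => (z.1 - 1, z.2)) ?_ ?_
    · intro z hz
      simp only [Finset.coe_sdiff, Set.mem_sdiff, Finset.mem_coe] at hz ⊢
      rcases mem_stepH.1 hz.1 with h | h
      · exact absurd h hz.2
      · exact ⟨h, fun h' => hz.2 (mem_stepH.2 (Or.inr h'))⟩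
    · rintro ⟨a, b⟩ _ ⟨a', b'⟩ _ h
      simpa using h
  rw [Finset.card_sdiff_of_subset (subset_stepH _), Finset.card_sdiff_of_subset (subset_stepH _)] at h
  have := Finset.card_le_card (subset_stepH D)
  have := Finset.card_le_card (subset_stepH (stepH D))
  omega

lemma stepV_concave (D : Finset (ℤ × ℤ)) :
    (stepV (stepV D)).card + D.card ≤ 2 * (stepV D).card := by
  have h : (stepV (stepV D) \ stepV D).card ≤ (stepV D \ D).card := by
    refine Finset.card_le_card_of_injOn (fun z => (z.1, z.2 - 1)) ?_ ?_
    · intro z hz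
      simp only [Finset.coe_sdiff, Set.mem_sdiff, Finset.mem_coe] at hz ⊢
      rcases mem_stepV.1 hz.1 with h | h
      · exact absurd h hz.2
      · exact ⟨h, fun h' => hz.2 (mem_stepV.2 (Or.inr h'))⟩
    · rintro ⟨a, b⟩ _ ⟨a', b'⟩ _ h
      simpa using h
  rw [Finset.card_sdiff_of_subset (subset_stepV _), Finset.card_sdiff_of_subset (subset_stepV _)] at h
  have := Finset.card_le_card (subset_stepV D)
  have := Finset.card_le_card (subset_stepV (stepV D))
  omega

lemma stepHV_comm (D : Finset (ℤ × ℤ)) : stepH (stepV D) = stepV (stepH D) := by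
  ext z; simp only [mem_stepH, mem_stepV]; tauto

noncomputable def stepB (D : Finset (ℤ × ℤ)) : Finset (ℤ × ℤ) := stepV (stepH D)

/-- dilation estimate: `|D ⊕ [0,r]²| ≤ |D| + r (ρ₁ + ρ₂) + c r²`. -/
lemma dilate_card {c : ℕ} (r : ℕ) : ∀ {D : Finset (ℤ × ℤ)} {p q : ℕ}, HasReps D c →
    (stepH D).card ≤ D.card + p → (stepV D).card ≤ D.card + q →
    ((stepB^[r]) D).card ≤ D.card + r * (p + q) + c * r ^ 2 := by
  induction r with
  | zero => intro D p q _ _ _; simp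
  | succ r ih =>
    intro D p q h hp hq
    rw [Function.iterate_succ_apply]
    have e1 := euler_le h
    have hHB : (stepH (stepB D)).card ≤ (stepB D).card + (p + c) := by
      -- ρ₁(V H D) ≤ ρ₁(H D) + c ≤ ρ₁ D + c
      have e2 := euler_le h.stepH
      have e3 := stepH_concave D
      unfold stepB
      rw [stepHV_comm]
      omega
    have hVB : (stepV (stepB D)).card ≤ (stepB D).card + (q + c) := by
      have e3 := stepV_concave (stepH D)
      unfold stepB
      omega
    have := ih (D := stepB D) h.stepH.stepV hHB hVB
    have hB : (stepB D).card ≤ D.card + p + q + c := by unfold stepB; omega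
    nlinarith

lemma mem_iter_stepB {D : Finset (ℤ × ℤ)} (r : ℕ) : ∀ {z : ℤ × ℤ} {i j : ℤ}, 0 ≤ i → i ≤ r → 0 ≤ j →
    j ≤ r → (z.1 - i, z.2 - j) ∈ D → z ∈ (stepB^[r]) D := by
  induction r with
  | zero =>
    intro z i j h1 h2 h3 h4 h
    have : i = 0 := by push_cast at h2; omega
    have : j = 0 := by push_cast at h4; omega
    subst_vars; simpa using h
  | succ r ih =>
    intro z i j h1 h2 h3 h4 h
    push_cast at h2 h4
    rw [Function.iterate_succ_apply']
    have key : ∀ a b : ℤ, (a = 0 ∨ a = 1) → (b = 0 ∨ b = 1) → (z.1 - a, z.2 - b) ∈ (stepB^[r]) D →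
        z ∈ stepB ((stepB^[r]) D) := by
      intro a b ha hb hm
      unfold stepB at hm ⊢
      simp only [mem_stepV, mem_stepH]
      rcases ha with rfl | rfl <;> rcases hb with rfl | rfl <;> (try simp only [sub_zero] at hm) <;> tauto
    refine key (if i = 0 then 0 else 1) (if j = 0 then 0 else 1) (by split_ifs <;> simp)
      (by split_ifs <;> simp) (ih (i := i - if i = 0 then 0 else 1) (j := j - if j = 0 then 0 else 1)
        ?_ ?_ ?_ ?_ ?_)
    · split_ifs <;> omega
    · split_ifs <;> omega
    · split_ifs <;> omega
    · split_ifs <;> omega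
    · simpa using h

/-- the square box of cells -/
noncomputable def cellBox (lo : ℤ) (m : ℕ) : Finset (ℤ × ℤ) := Finset.Ico lo (lo + m) ×ˢ Finset.Ico lo (lo + m)

lemma mem_cellBox {lo : ℤ} {m : ℕ} {z : ℤ × ℤ} : z ∈ cellBox lo m ↔
    (lo ≤ z.1 ∧ z.1 < lo + m) ∧ (lo ≤ z.2 ∧ z.2 < lo + m) := by
  simp [cellBox]

lemma card_cellBox (lo : ℤ) (m : ℕ) : (cellBox lo m).card = m ^ 2 := by
  simp [cellBox, sq]

lemma erode_card {lo : ℤ} {m k p q : ℕ} (hm : 0 < m) {D : Finset (ℤ × ℤ)} (hD : D ⊆ cellBox lo m)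
    (hrep : HasReps D (k + 1)) (hp : (stepH D).card ≤ D.card + (m + p))
    (hq : (stepV D).card ≤ D.card + (m + q))
    (hbd : ∀ z ∈ cellBox lo m, (z.1 = lo ∨ z.1 = lo + m - 1 ∨ z.2 = lo ∨ z.2 = lo + m - 1) → z ∈ D)
    (R : ℕ) :
    ∃ G : Finset (ℤ × ℤ), (∀ z ∈ G, ∀ i j : ℤ, |i| ≤ R → |j| ≤ R →
      (z.1 + i, z.2 + j) ∈ cellBox lo m \ D) ∧
      (cellBox lo m \ D).card ≤ G.card + 2 * R * (p + q) + 4 * k * R ^ 2 := by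
  set G0 := cellBox lo (m + 2 * R) \ (stepB^[2 * R]) D with hG0
  have hcard := dilate_card (2 * R) hrep hp hq
  have h1 : (m + 2 * R) ^ 2 ≤ G0.card + ((stepB^[2 * R]) D).card := by
    rw [← card_cellBox lo]
    exact Finset.card_le_card_sdiff_add_card
  have h2 : (cellBox lo m \ D).card + D.card = m ^ 2 := by
    rw [← card_cellBox lo, Finset.card_sdiff_add_card_eq_card hD]
  have hinj : Function.Injective (fun z : ℤ × ℤ => (z.1 - (R : ℤ), z.2 - (R : ℤ))) := by
    rintro ⟨a, b⟩ ⟨c, d⟩ h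
    simpa using h
  refine ⟨G0.image (fun z => (z.1 - R, z.2 - R)), ?_, ?_⟩
  · intro z hz i j hi hj
    obtain ⟨w, hw, rfl⟩ := Finset.mem_image.1 hz
    rw [abs_le] at hi hj
    simp only [hG0, Finset.mem_sdiff] at hw
    have hnot : ∀ a b : ℤ, 0 ≤ a → a ≤ 2 * R → 0 ≤ b → b ≤ 2 * R → (w.1 - a, w.2 - b) ∉ D :=
      fun a b h1 h2 h3 h4 h => hw.2 (mem_iter_stepB (2 * R) h1 (by push_cast; omega) h3
        (by push_cast; omega) h)
    have hb := mem_cellBox.1 hw.1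
    push_cast at hb
    have hnD : ∀ x y : ℤ, w.1 - 2 * R ≤ x → x ≤ w.1 → w.2 - 2 * R ≤ y → y ≤ w.2 →
        (x, y) ∉ D := by
      intro x y h1 h2 h3 h4
      have := hnot (w.1 - x) (w.2 - y) (by omega) (by omega) (by omega) (by omega)
      simpa using this
    have hbd' : ∀ x y : ℤ, w.1 - 2 * R ≤ x → x ≤ w.1 → w.2 - 2 * R ≤ y → y ≤ w.2 →
        lo ≤ x → x < lo + m → lo ≤ y → y < lo + m → x ≠ lo ∧ x ≠ lo + m - 1 ∧ y ≠ lo ∧ y ≠ lo + m - 1 := by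
      intro x y h1 h2 h3 h4 h5 h6 h7 h8
      by_contra hcon
      refine hnD x y h1 h2 h3 h4 (hbd (x, y) (mem_cellBox.2 ⟨⟨h5, h6⟩, h7, h8⟩) ?_)
      simp only
      tauto
    refine Finset.mem_sdiff.2 ⟨?_, hnD _ _ (by omega) (by omega) (by omega) (by omega)⟩
    have x0 : ∃ x, w.1 - 2 * R ≤ x ∧ x ≤ w.1 ∧ lo ≤ x ∧ x < lo + m := by
      refine ⟨min w.1 (lo + m - 1), ?_, ?_, ?_, ?_⟩ <;> omega
    have y0 : ∃ y, w.2 - 2 * R ≤ y ∧ y ≤ w.2 ∧ lo ≤ y ∧ y < lo + m := by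
      refine ⟨min w.2 (lo + m - 1), ?_, ?_, ?_, ?_⟩ <;> omega
    obtain ⟨x, a1, a2, a3, a4⟩ := x0
    obtain ⟨y, b1, b2, b3, b4⟩ := y0
    have c1 : lo ≤ w.1 - 2 * R := by
      by_contra hc
      exact (hbd' lo y (by omega) (by omega) b1 b2 le_rfl (by omega) b3 b4).1 rfl
    have c2 : w.1 < lo + m := by
      by_contra hc
      exact (hbd' (lo + m - 1) y (by omega) (by omega) b1 b2 (by omega) (by omega) b3 b4).2.1 rfl
    have c3 : lo ≤ w.2 - 2 * R := by
      by_contra hc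
      exact (hbd' x lo a1 a2 (by omega) (by omega) a3 a4 le_rfl (by omega)).2.2.1 rfl
    have c4 : w.2 < lo + m := by
      by_contra hc
      exact (hbd' x (lo + m - 1) a1 a2 (by omega) (by omega) a3 a4 (by omega) (by omega)).2.2.2 rfl
    exact mem_cellBox.2 ⟨⟨by simp only; omega, by simp only; omega⟩, by simp only; omega, by simp only; omega⟩
  · rw [Finset.card_image_of_injective _ hinj]
    nlinarith

lemma card_le_mul_ends (Z : Finset (ℤ × ℤ)) :
    Z.card ≤ (Z.filter fun z => (z.1 - 1, z.2) ∉ Z).card * (Z.filter fun z => (z.1, z.2 - 1) ∉ Z).card := by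
  have h1 : (Z.image Prod.snd).card ≤ (Z.filter fun z => (z.1 - 1, z.2) ∉ Z).card := by
    refine le_trans (Finset.card_le_card ?_) (Finset.card_image_le (f := Prod.snd))
    intro y hy
    obtain ⟨⟨x, y'⟩, hz, rfl⟩ := Finset.mem_image.1 hy
    obtain ⟨w, hw, hmin⟩ := (Z.filter fun z => z.2 = y').exists_min_image Prod.fst ⟨(x, y'), by simpa using hz⟩
    simp only [Finset.mem_filter] at hw hmin
    refine Finset.mem_image.2 ⟨w, Finset.mem_filter.2 ⟨hw.1, fun hc => ?_⟩, hw.2⟩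
    have := hmin _ ⟨hc, hw.2⟩
    simp at this
  have h2 : (Z.image Prod.fst).card ≤ (Z.filter fun z => (z.1, z.2 - 1) ∉ Z).card := by
    refine le_trans (Finset.card_le_card ?_) (Finset.card_image_le (f := Prod.fst))
    intro y hy
    obtain ⟨⟨x, y'⟩, hz, rfl⟩ := Finset.mem_image.1 hy
    obtain ⟨w, hw, hmin⟩ := (Z.filter fun z => z.1 = x).exists_min_image Prod.snd ⟨(x, y'), by simpa using hz⟩
    simp only [Finset.mem_filter] at hw hmin
    refine Finset.mem_image.2 ⟨w, Finset.mem_filter.2 ⟨hw.1, fun hc => ?_⟩, hw.2⟩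
    have := hmin _ ⟨hc, hw.2⟩
    simp at this
  have h3 : Z ⊆ (Z.image Prod.fst) ×ˢ (Z.image Prod.snd) := by
    rintro ⟨x, y⟩ hz
    simp only [Finset.mem_product, Finset.mem_image]
    exact ⟨⟨_, hz, rfl⟩, _, hz, rfl⟩
  have := Finset.card_le_card h3
  rw [Finset.card_product] at this
  nlinarith

lemma card_shift_le (e : ℤ × ℤ) (Z : Finset (ℤ × ℤ)) (N : ℕ) :
    (Z.filter fun z => z - N • e ∉ Z).card ≤ N * (Z.filter fun z => z - e ∉ Z).card := by
  induction N with
  | zero => simp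
  | succ N ih =>
    have hs : (Z.filter fun z => z - (N + 1) • e ∉ Z) ⊆
        (Z.filter fun z => z - N • e ∉ Z) ∪ ((Z.filter fun z => z - e ∉ Z).image fun z => z + N • e) := by
      intro z hz
      simp only [Finset.mem_union, Finset.mem_filter, Finset.mem_image] at hz ⊢
      by_cases h : z - N • e ∈ Z
      · right
        refine ⟨z - N • e, ⟨h, ?_⟩, by simp⟩
        have := hz.2
        rwa [succ_nsmul, ← sub_sub] at this
      · exact Or.inl ⟨hz.1, h⟩
    have := (Finset.card_le_card hs).trans (Finset.card_union_le _ _)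
    have h2 := Finset.card_image_le (s := Z.filter fun z => z - e ∉ Z) (f := fun z => z + N • e)
    nlinarith

lemma hasDerivAt_trans {Ω : Set E2} (hfin : volume Ω ≠ ⊤) {ψ : E2 → ℝ}
    (hψ : ContDiff ℝ 1 ψ) (hc : HasCompactSupport ψ) (v : E2) (s : ℝ) :
    HasDerivAt (fun s : ℝ => ∫ x in Ω, ψ (x - s • v))
      (∫ x in Ω, -(fderiv ℝ ψ (x - s • v) v)) s := by
  have hd : Differentiable ℝ ψ := hψ.differentiable (by norm_num)
  have hfc : Continuous (fderiv ℝ ψ) := hψ.continuous_fderiv (by norm_num)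
  have hfs : HasCompactSupport (fderiv ℝ ψ) := hc.fderiv (𝕜 := ℝ)
  obtain ⟨C, hC⟩ := hfs.exists_bound_of_continuous hfc
  obtain ⟨C0, hC0⟩ := hc.exists_bound_of_continuous hψ.continuous
  have : IsFiniteMeasure (volume.restrict Ω) := ⟨by simpa using hfin.lt_top⟩
  refine (hasDerivAt_integral_of_dominated_loc_of_deriv_le
    (F := fun (s : ℝ) (x : E2) => ψ (x - s • v))
    (F' := fun (s : ℝ) (x : E2) => -(fderiv ℝ ψ (x - s • v) v))
    (bound := fun _ => C * ‖v‖) (s := univ) Filter.univ_mem ?_ ?_ ?_ ?_ ?_ ?_).2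
  · refine Eventually.of_forall fun s => Continuous.aestronglyMeasurable ?_
    exact hψ.continuous.comp (by fun_prop)
  · refine Integrable.of_bound (C := C0) (Continuous.aestronglyMeasurable (hψ.continuous.comp (by fun_prop))) (Eventually.of_forall fun x => hC0 _)
  · refine Continuous.aestronglyMeasurable ?_
    have : Continuous fun x : E2 => fderiv ℝ ψ (x - s • v) := hfc.comp (by fun_prop)
    fun_prop
  · refine Eventually.of_forall fun x s _ => ?_
    rw [norm_neg]
    exact (ContinuousLinearMap.le_opNorm _ _).trans (by gcongr; exact hC _)
  · exact integrable_const _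
  · refine Eventually.of_forall fun x s _ => ?_
    have h1 : HasDerivAt (fun s : ℝ => x - s • v) (-v) s := by
      have := ((hasDerivAt_id s).smul_const v).const_sub x
      simpa using this
    have := (hd (x - s • v)).hasFDerivAt.comp_hasDerivAt s h1
    have h3 : HasDerivAt (fun s : ℝ => ψ (x - s • v)) _ s := this
    simpa using h3

lemma divg_mk (f : Fin 2 → E2 → ℝ) (hf : ∀ i, Differentiable ℝ (f i)) (x : E2) :
    divg (fun x => WithLp.toLp 2 (fun i => f i x)) x
      = ∑ i, fderiv ℝ (f i) x (EuclideanSpace.single i 1) := by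
  unfold divg
  refine Finset.sum_congr rfl fun i _ => ?_
  have hD : DifferentiableAt ℝ (fun x => (WithLp.toLp 2 (fun i => f i x) : E2)) x := by
    rw [differentiableAt_euclidean]
    exact fun i => hf i x
  have h2 := (EuclideanSpace.proj (𝕜 := ℝ) i).hasFDerivAt.comp x hD.hasFDerivAt
  have h3 : HasFDerivAt (f i) _ x := h2
  rw [h3.fderiv]
  rfl

lemma le_perimeter {Ω : Set E2} (hB : BddAbove (perimSet Ω)) (f : Fin 2 → E2 → ℝ)
    (hf : ∀ i, ContDiff ℝ 1 (f i)) (hc : ∀ i, HasCompactSupport (f i))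
    (hn : ∀ x, (f 0 x)^2 + (f 1 x)^2 ≤ 1) :
    ∫ x in Ω, (∑ i, fderiv ℝ (f i) x (EuclideanSpace.single i 1)) ≤ perimeter Ω := by
  refine le_csSup hB ⟨fun x => WithLp.toLp 2 (fun i => f i x), ?_, ?_, ?_, ?_⟩
  · rw [contDiff_euclidean]; exact hf
  · refine HasCompactSupport.intro ((hc 0).isCompact.union (hc 1).isCompact) fun x hx => ?_
    rw [mem_union, not_or] at hx
    ext i
    fin_cases i
    · exact image_eq_zero_of_notMem_tsupport (f := f 0) hx.1
    · exact image_eq_zero_of_notMem_tsupport (f := f 1) hx.2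
  · intro x
    rw [EuclideanSpace.norm_eq, Real.sqrt_le_one]
    simpa using hn x
  · congr 1; ext x
    rw [divg_mk f (fun i => (hf i).differentiable (by norm_num))]

lemma comp_sub_props {ψ : E2 → ℝ} (hψ : ContDiff ℝ 1 ψ) (hc : HasCompactSupport ψ) (c : ℝ) (w : E2) :
    ContDiff ℝ 1 (fun x => c * ψ (x - w)) ∧ HasCompactSupport (fun x => c * ψ (x - w)) ∧
    ∀ x v, fderiv ℝ (fun x => c * ψ (x - w)) x v = c * fderiv ℝ ψ (x - w) v := by
  refine ⟨contDiff_const.mul (hψ.comp (contDiff_id.sub contDiff_const)), ?_, ?_⟩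
  · have h1 : HasCompactSupport (fun x => ψ (x - w)) := by
      have := hc.comp_homeomorph (Homeomorph.subRight w)
      exact this
    exact h1.mul_left
  · intro x v
    have hd : Differentiable ℝ ψ := hψ.differentiable (by norm_num)
    have h := (((hd (x - w)).hasFDerivAt).comp x ((hasFDerivAt_id x).sub_const w)).const_mul c
    have h' : HasFDerivAt (fun x => c * ψ (x - w)) _ x := h
    rw [h'.fderiv]
    simp

/-- Key one-sided bound on translation differences. -/
lemma trans_le {Ω : Set E2} (hfin : volume Ω ≠ ⊤) (hB : BddAbove (perimSet Ω))
    (ψ : Fin 2 → E2 → ℝ) (hψ : ∀ i, ContDiff ℝ 1 (ψ i)) (hc : ∀ i, HasCompactSupport (ψ i))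
    (hn : ∀ i x, |ψ i x| ≤ 1) {h : ℝ} (hh : 0 ≤ h) :
    (∑ i, ∫ x in Ω, ψ i (x - h • EuclideanSpace.single i 1)) - (∑ i, ∫ x in Ω, ψ i x)
      ≤ √2 * perimeter Ω * h := by
  set F : ℝ → ℝ := fun s => ∑ i, ∫ x in Ω, ψ i (x - s • EuclideanSpace.single i 1) with hF
  have hder : ∀ s, HasDerivAt F (∑ i, ∫ x in Ω, -(fderiv ℝ (ψ i) (x - s • EuclideanSpace.single i 1) (EuclideanSpace.single i 1))) s := by
    intro s
    have := HasDerivAt.fun_sum (u := Finset.univ) (fun i _ => hasDerivAt_trans hfin (hψ i) (hc i) (EuclideanSpace.single i 1) s)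
    exact this
  have : IsFiniteMeasure (volume.restrict Ω) := ⟨by simpa using hfin.lt_top⟩
  have key : ∀ s, deriv F s ≤ √2 * perimeter Ω := by
    intro s
    rw [(hder s).deriv]
    have hs2 : (0:ℝ) < √2 := by positivity
    have hs3 : (√2)^2 = 2 := Real.sq_sqrt (by norm_num)
    have P := fun i : Fin 2 => comp_sub_props (hψ i) (hc i) (-(1/√2)) (s • EuclideanSpace.single i 1)
    have := le_perimeter hB (fun i x => (-(1/√2)) * ψ i (x - s • EuclideanSpace.single i 1))
      (fun i => (P i).1) (fun i => (P i).2.1) (by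
        intro x
        have e : ∀ y, |y| ≤ 1 → (-(1/√2) * y)^2 ≤ 1/2 := by
          intro y hy
          have : y^2 ≤ 1 := by rw [sq_le_one_iff_abs_le_one]; exact hy
          rw [mul_pow, neg_sq, div_pow, hs3]; linarith
        have := e _ (hn 0 (x - s • EuclideanSpace.single 0 1))
        have := e _ (hn 1 (x - s • EuclideanSpace.single 1 1))
        linarith)
    rw [integral_finsetSum] at this
    · simp only [fun i : Fin 2 => (P i).2.2] at this
      have e2 : ∀ i : Fin 2, (∫ x in Ω, -(fderiv ℝ (ψ i) (x - s • EuclideanSpace.single i 1) (EuclideanSpace.single i 1)))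
          = √2 * ∫ x in Ω, -(1/√2) * (fderiv ℝ (ψ i) (x - s • EuclideanSpace.single i 1) (EuclideanSpace.single i 1)) := by
        intro i
        rw [← integral_const_mul]
        congr 1; ext x; field_simp
      simp only [e2]
      rw [← Finset.mul_sum]
      gcongr
    · intro i _
      have hfc : Continuous (fderiv ℝ (fun x => (-(1/√2)) * ψ i (x - s • EuclideanSpace.single i 1))) :=
        (P i).1.continuous_fderiv (by norm_num)
      have hfs := (P i).2.1.fderiv_apply (𝕜 := ℝ) (EuclideanSpace.single i 1)
      refine (Continuous.integrable_of_hasCompactSupport (by fun_prop) hfs).integrableOn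
  have := image_sub_le_mul_sub_of_deriv_le (fun s => (hder s).differentiableAt) key hh
  simpa [hF] using this

/-- Boundedness of the perimeter set from linear translation estimates. -/
lemma bddAbove_of_trans {Ω : Set E2} (hfin : volume Ω ≠ ⊤) {C r0 : ℝ} (hr0 : 0 < r0)
    (hC : ∀ i : Fin 2, ∀ τ, 0 < τ → τ < r0 → 
      ∀ ψ : E2 → ℝ, ContDiff ℝ 1 ψ → HasCompactSupport ψ → (∀ x, |ψ x| ≤ 1) →
      (∫ x in Ω, ψ x) - (∫ x in Ω, ψ (x - τ • EuclideanSpace.single i 1)) ≤ C * τ) :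
    BddAbove (perimSet Ω) := by
  refine ⟨2 * C, ?_⟩
  rintro r ⟨φ, hφ, hc, hn, rfl⟩
  have hd : Differentiable ℝ φ := hφ.differentiable (by norm_num)
  have : IsFiniteMeasure (volume.restrict Ω) := ⟨by simpa using hfin.lt_top⟩
  have hci : ∀ i, HasCompactSupport (fun x => φ x i) := fun i => 
    hc.comp_left (g := fun y : E2 => y i) rfl
  have hφi : ∀ i, ContDiff ℝ 1 (fun x => φ x i) := contDiff_euclidean.1 hφ
  have hni : ∀ i x, |φ x i| ≤ 1 := fun i x => by
    have := (EuclideanSpace.norm_eq (φ x))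
    have h2 := hn x
    have h3 : ‖φ x i‖ ≤ ‖φ x‖ := PiLp.norm_apply_le _ _
    rw [Real.norm_eq_abs] at h3
    linarith
  have e : ∀ x, divg φ x = ∑ i, fderiv ℝ (fun x => φ x i) x (EuclideanSpace.single i 1) := by
    intro x
    exact divg_mk (fun i x => φ x i) (fun i => (hφi i).differentiable (by norm_num)) x
  simp only [e]
  rw [integral_finsetSum]
  · have : ∀ i : Fin 2, ∫ x in Ω, fderiv ℝ (fun x => φ x i) x (EuclideanSpace.single i 1) ≤ C := by
      intro i
      have h := hasDerivAt_trans hfin (hφi i) (hci i) (EuclideanSpace.single i 1) 0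
      have h2 := h.tendsto_slope_zero_right.neg
      simp only [zero_smul, sub_zero, zero_add, integral_neg, neg_neg] at h2
      refine le_of_tendsto h2 ?_
      filter_upwards [Ioo_mem_nhdsGT hr0] with τ hτ
      have := hC i τ hτ.1 hτ.2 _ (hφi i) (hci i) (hni i)
      rw [smul_eq_mul, ← mul_neg, neg_sub, inv_mul_le_iff₀ hτ.1, mul_comm τ]
      exact this
    rw [Fin.sum_univ_two]
    linarith [this 0, this 1]
  · intro i _
    have hfc : Continuous (fderiv ℝ (fun x => φ x i)) := (hφi i).continuous_fderiv (by norm_num)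
    have hfs := (hci i).fderiv_apply (𝕜 := ℝ) (EuclideanSpace.single i 1)
    refine (Continuous.integrable_of_hasCompactSupport (by fun_prop) hfs).integrableOn

lemma exists_cutoff {A B : Set E2} (hA : IsCompact A) (hB : IsCompact B) (hd : Disjoint A B) :
    ∃ χ : E2 → ℝ, ContDiff ℝ 1 χ ∧ HasCompactSupport χ ∧ (∀ x ∈ A, χ x = 1) ∧
      (∀ x ∈ B, χ x = 0) ∧ ∀ x, 0 ≤ χ x ∧ χ x ≤ 1 := by
  obtain ⟨R, hR⟩ := hA.isBounded.subset_ball 0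
  obtain ⟨f, hf0, hf1, hf⟩ := exists_contMDiffMap_zero_one_of_isClosed (n := 1) (modelWithCornersSelf ℝ E2)
    (s := B ∪ (ball 0 R)ᶜ) (t := A) (hB.isClosed.union isOpen_ball.isClosed_compl) hA.isClosed (by
      rw [disjoint_union_left]
      exact ⟨hd.symm, disjoint_compl_left_iff_subset.2 hR⟩)
  refine ⟨f, f.contMDiff.contDiff, ?_, fun x hx => hf1 hx, fun x hx => hf0 (Or.inl hx), fun x => hf x⟩
  refine HasCompactSupport.intro (isCompact_closedBall (0:E2) R) fun x hx => hf0 (Or.inr fun h => hx (ball_subset_closedBall h))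

lemma int_lower {ψ : E2 → ℝ} (hψ : Continuous ψ) (h1 : ∀ x, |ψ x| ≤ 1) {A A' : Set E2}
    (hA : MeasurableSet A) (hA' : MeasurableSet A') (hs : A' ⊆ A) (hfin : volume A ≠ ⊤)
    (hv : ∀ x ∈ A', ψ x = 1) {δ : ℝ} (hδ : volume.real A ≤ volume.real A' + δ) :
    volume.real A - 2 * δ ≤ ∫ x in A, ψ x := by
  have hfin' : volume A' ≠ ⊤ := measure_ne_top_of_subset hs hfin
  have hfin2 : volume (A \ A') ≠ ⊤ := measure_ne_top_of_subset sdiff_subset hfin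
  have hIntegr : ∀ S : Set E2, volume S ≠ ⊤ → IntegrableOn ψ S := fun S hS => by
    have : IsFiniteMeasure (volume.restrict S) := ⟨by simpa using hS.lt_top⟩
    exact Integrable.of_bound (C := 1) hψ.aestronglyMeasurable (Eventually.of_forall fun x => h1 x)
  have e : ∫ x in A, ψ x = (∫ x in A', ψ x) + ∫ x in A \ A', ψ x := by
    rw [← setIntegral_union disjoint_sdiff_right (hA.diff hA') (hIntegr _ hfin') (hIntegr _ hfin2), union_sdiff_cancel hs]
  have e1 : ∫ x in A', ψ x = volume.real A' := by
    rw [setIntegral_congr_fun hA' (g := fun _ => (1:ℝ)) (fun x hx => hv x hx)]; simp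
  have e2 : |∫ x in A \ A', ψ x| ≤ 1 * volume.real (A \ A') := by
    rw [← Real.norm_eq_abs]
    exact norm_setIntegral_le_of_norm_le_const hfin2.lt_top fun x _ => h1 x
  have e3 : volume.real (A \ A') = volume.real A - volume.real A' := measureReal_sdiff hs hA' hfin
  rw [abs_le] at e2
  linarith [e2.1]

lemma approx_fun {A B : Set E2} (hA : MeasurableSet A) (hB : MeasurableSet B) (hd : Disjoint A B)
    (hAf : volume A ≠ ⊤) (hBf : volume B ≠ ⊤) {δ : ℝ} (hδ : 0 < δ) :
    ∃ ψ : E2 → ℝ, ContDiff ℝ 1 ψ ∧ HasCompactSupport ψ ∧ (∀ x, |ψ x| ≤ 1) ∧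
      volume.real A + volume.real B - 4 * δ ≤ (∫ x in A, ψ x) - ∫ x in B, ψ x := by
  obtain ⟨A', hA', cA, lA⟩ := hA.exists_isCompact_lt_add hAf (ε := ENNReal.ofReal δ) (by simpa using hδ)
  obtain ⟨B', hB', cB, lB⟩ := hB.exists_isCompact_lt_add hBf (ε := ENNReal.ofReal δ) (by simpa using hδ)
  have conv : ∀ S S' : Set E2, volume S ≠ ⊤ → volume S' ≠ ⊤ → volume S < volume S' + ENNReal.ofReal δ →
      volume.real S ≤ volume.real S' + δ := by
    intro S S' h1 h2 h3
    have := ENNReal.toReal_mono (by finiteness) h3.le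
    rwa [ENNReal.toReal_add h2 (by finiteness), ENNReal.toReal_ofReal hδ.le] at this
  have lA' := conv _ _ hAf cA.measure_lt_top.ne lA
  have lB' := conv _ _ hBf cB.measure_lt_top.ne lB
  have hd' := hd.mono hA' hB'
  obtain ⟨f, f1, f2, f3, f4, f5⟩ := exists_cutoff cA cB hd'
  obtain ⟨g, g1, g2, g3, g4, g5⟩ := exists_cutoff cB cA hd'.symm
  have hb : ∀ x, |f x - g x| ≤ 1 := fun x => by
    rw [abs_le]; constructor <;> linarith [f5 x, g5 x, (f5 x).1, (f5 x).2, (g5 x).1, (g5 x).2]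
  refine ⟨fun x => f x - g x, f1.sub g1, f2.sub g2, hb, ?_⟩
  have i1 := int_lower (f1.sub g1).continuous hb hA cA.measurableSet hA' hAf
    (fun x hx => by simp [f3 x hx, g4 x hx]) lA'
  have i2 := int_lower (g1.sub f1).continuous (fun x => by rw [abs_sub_comm]; exact hb x) hB cB.measurableSet hB' hBf
    (fun x hx => by simp [g3 x hx, f4 x hx]) lB'
  have i3 : ∫ x in B, (g x - f x) = - ∫ x in B, (f x - g x) := by
    rw [← integral_neg]; congr 1; ext x; ring
  rw [i3] at i2
  linarith

def gainSet (Ω : Set E2) (v : E2) : Set E2 := {x | x ∉ Ω ∧ x + v ∈ Ω}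

lemma gainSet_meas {Ω : Set E2} (hO : MeasurableSet Ω) (v : E2) : MeasurableSet (gainSet Ω v) :=
  hO.compl.inter (hO.preimage (measurable_add_const v))

lemma gainSet_fin {Ω : Set E2} (hfin : volume Ω ≠ ⊤) (v : E2) : volume (gainSet Ω v) ≠ ⊤ := by
  have hsub : gainSet Ω v ⊆ (fun x => x + v) ⁻¹' Ω := fun x hx => hx.2
  refine measure_ne_top_of_subset hsub ?_
  rwa [measure_preimage_add_right]

/-- difference of integrals of a translate -/
lemma trans_diff {Ω : Set E2} (hO : MeasurableSet Ω) (hfin : volume Ω ≠ ⊤) (v : E2) :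
    ∃ B, MeasurableSet B ∧ B ⊆ Ω ∧ Disjoint (gainSet Ω v) B ∧ 
      volume.real B = volume.real (gainSet Ω v) ∧ 
    ∀ ψ : E2 → ℝ, Continuous ψ → (∀ x, |ψ x| ≤ 1) →
    (∫ x in Ω, ψ (x - v)) - (∫ x in Ω, ψ x) = (∫ x in gainSet Ω v, ψ x) - ∫ x in B, ψ x := by
  set Ω' := (fun x => x + v) ⁻¹' Ω with hΩ'
  have mO' : MeasurableSet Ω' := hO.preimage (measurable_add_const v)
  have hv : volume Ω' = volume Ω := measure_preimage_add_right _ _ _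
  have hfin' : volume Ω' ≠ ⊤ := by rwa [hv]
  have hA : gainSet Ω v = Ω' \ Ω := by
    ext x; simp [gainSet, hΩ', and_comm]
  refine ⟨Ω \ Ω', hO.diff mO', sdiff_subset, ?_, ?_, ?_⟩
  · rw [hA]; exact disjoint_sdiff_sdiff
  · rw [hA]
    have a1 := measureReal_sdiff_add_inter (μ := volume) (s := Ω) mO' hfin
    have a2 := measureReal_sdiff_add_inter (μ := volume) (s := Ω') hO hfin'
    rw [inter_comm] at a2
    have : volume.real Ω' = volume.real Ω := by rw [measureReal_def, hv]; rfl
    linarith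
  · intro ψ hψ h1
    have hIntegr : ∀ S : Set E2, volume S ≠ ⊤ → IntegrableOn ψ S := fun S hS => by
      have : IsFiniteMeasure (volume.restrict S) := ⟨by simpa using hS.lt_top⟩
      exact Integrable.of_bound (C := 1) hψ.aestronglyMeasurable (Eventually.of_forall fun x => h1 x)
    have s1 : ∫ x in Ω, ψ (x - v) = ∫ x in Ω', ψ x := by
      have mp : MeasurePreserving (fun x : E2 => x + v) volume volume := measurePreserving_add_right _ _
      have := mp.setIntegral_preimage_emb (MeasurableEquiv.addRight v).measurableEmbedding (fun x => ψ (x - v)) Ω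
      rw [← this]
      simp [hΩ']
    have b1 := integral_inter_add_sdiff (μ := volume) (s := Ω) (t := Ω') (f := ψ) mO' (hIntegr _ hfin)
    have b2 := integral_inter_add_sdiff (μ := volume) (s := Ω') (t := Ω) (f := ψ) hO (hIntegr _ hfin')
    rw [inter_comm] at b2
    rw [s1, hA]
    linarith

lemma gain_le {Ω : Set E2} (hO : MeasurableSet Ω) (hfin : volume Ω ≠ ⊤) (hB : BddAbove (perimSet Ω))
    {h : ℝ} (hh : 0 ≤ h) :
    √2 * (volume.real (gainSet Ω (h • EuclideanSpace.single 0 1)) + volume.real (gainSet Ω (h • EuclideanSpace.single 1 1)))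
      ≤ perimeter Ω * h := by
  have hs3 : (√2) * √2 = 2 := Real.mul_self_sqrt (by norm_num)
  have hs2 : (0:ℝ) < √2 := by positivity
  suffices H : ∀ δ > 0, 2 * (volume.real (gainSet Ω (h • EuclideanSpace.single 0 1)) + volume.real (gainSet Ω (h • EuclideanSpace.single 1 1))) - 8 * δ ≤ √2 * perimeter Ω * h by
    have h2 : 2 * (volume.real (gainSet Ω (h • EuclideanSpace.single 0 1)) + volume.real (gainSet Ω (h • EuclideanSpace.single 1 1))) ≤ √2 * perimeter Ω * h := by
      refine le_of_forall_pos_le_add fun δ hδ => ?_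
      linarith [H (δ/8) (by positivity)]
    refine le_of_mul_le_mul_left ?_ hs2
    rw [← mul_assoc, hs3, ← mul_assoc]
    exact h2
  intro δ hδ
  have ex : ∀ i : Fin 2, ∃ ψ : E2 → ℝ, ContDiff ℝ 1 ψ ∧ HasCompactSupport ψ ∧ (∀ x, |ψ x| ≤ 1) ∧
      2 * volume.real (gainSet Ω (h • EuclideanSpace.single i 1)) - 4 * δ ≤ 
      (∫ x in Ω, ψ (x - h • EuclideanSpace.single i 1)) - (∫ x in Ω, ψ x) := by
    intro i
    set v : E2 := h • EuclideanSpace.single i 1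
    obtain ⟨B, mB, sB, dB, vB, H⟩ := trans_diff hO hfin v
    have hBf : volume B ≠ ⊤ := measure_ne_top_of_subset sB hfin
    obtain ⟨ψ, q1, q2, q3, q4⟩ := approx_fun (gainSet_meas hO v) mB dB (gainSet_fin hfin v) hBf hδ
    refine ⟨ψ, q1, q2, q3, ?_⟩
    rw [H ψ q1.continuous q3]
    linarith
  choose ψ p1 p2 p3 p4 using ex
  have := trans_le hfin hB ψ p1 p2 p3 hh
  rw [Fin.sum_univ_two, Fin.sum_univ_two] at this
  linarith [p4 0, p4 1]

lemma coord_le (x : E2) (i : Fin 2) : |x i| ≤ ‖x‖ := by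
  have h3 : ‖x i‖ ≤ ‖x‖ := PiLp.norm_apply_le _ _
  rwa [Real.norm_eq_abs] at h3

lemma norm_le_coord (x : E2) : ‖x‖ ≤ |x 0| + |x 1| := by
  rw [EuclideanSpace.norm_eq, Real.sqrt_le_left (by positivity)]
  simp only [Fin.sum_univ_two, Real.norm_eq_abs]
  nlinarith [abs_nonneg (x 0), abs_nonneg (x 1)]

lemma frontier_graph {Ω : Set E2} (hO : IsOpen Ω) {x0 : E2} {g : E2 ≃ₗᵢ[ℝ] E2} {f : ℝ → ℝ} {ε : ℝ}
    (hf : Continuous f)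
    (h : Ω ∩ ball x0 ε = {y ∈ ball x0 ε | f ((g (y - x0)) 0) < (g (y - x0)) 1})
    {y : E2} (hy : y ∈ frontier Ω) (hyb : y ∈ ball x0 ε) :
    f ((g (y - x0)) 0) = (g (y - x0)) 1 := by
  have hyΩ : y ∉ Ω := by rw [hO.frontier_eq] at hy; exact hy.2
  apply le_antisymm
  · by_contra hlt
    push Not at hlt
    have hc0 : Continuous fun y : E2 => (g (y - x0)) 0 := by fun_prop
    have hc1 : Continuous fun y : E2 => (g (y - x0)) 1 := by fun_prop
    have : ∀ᶠ z in 𝓝 y, (g (z - x0)) 1 < f ((g (z - x0)) 0) :=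
      (hc1.continuousAt).eventually_lt ((hf.comp hc0).continuousAt) hlt
    have h2 : ∀ᶠ z in 𝓝 y, z ∈ ball x0 ε := isOpen_ball.mem_nhds hyb
    have hcl : y ∈ closure Ω := hy.1
    rw [mem_closure_iff_frequently] at hcl
    obtain ⟨z, hz, hz1, hz2⟩ := (hcl.and_eventually (this.and h2)).exists
    have : z ∈ Ω ∩ ball x0 ε := ⟨hz, hz2⟩
    rw [h] at this
    exact lt_asymm this.2 hz1
  · by_contra hlt
    push Not at hlt
    have : y ∈ Ω ∩ ball x0 ε := by rw [h]; exact ⟨hyb, hlt⟩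
    exact hyΩ this.1

lemma preconn_frontier {Ω : Set E2} (hO : IsOpen Ω) {U : Set E2} (hU : IsPreconnected U)
    (h1 : (U ∩ Ω).Nonempty) (h2 : (U ∩ Ωᶜ).Nonempty) : (U ∩ frontier Ω).Nonempty := by
  by_contra hne
  have hx : ∀ x ∈ U, x ∉ frontier Ω := fun x hx hf => hne ⟨x, hx, hf⟩
  simp only [hO.frontier_eq, Set.mem_sdiff, not_and, not_not] at hx
  obtain ⟨y, hy, hyΩ⟩ := h2
  obtain ⟨z, hz, hz1, hz2⟩ := hU Ω (closure Ω)ᶜ hO isClosed_closure.isOpen_compl (fun x hxU => by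
    by_cases hc : x ∈ closure Ω
    · exact Or.inl (hx x hxU hc)
    · exact Or.inr hc) h1 ⟨y, hy, fun hc => hyΩ (hx y hy hc)⟩
  exact hz2 (subset_closure hz1)

def TubeProp (S : Set E2) : Prop :=
  ∃ C r0 : ℝ, 0 ≤ C ∧ 0 < r0 ∧ ∀ r, 0 < r → r < r0 → volume (thickening r S) ≤ ENNReal.ofReal (C * r)

lemma tube_local {Ω : Set E2} (hO : IsOpen Ω) {x0 : E2} {g : E2 ≃ₗᵢ[ℝ] E2} {f : ℝ → ℝ} {K : NNReal} {ε : ℝ}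
    (hε : 0 < ε) (hf : LipschitzWith K f)
    (h : Ω ∩ ball x0 ε = {y ∈ ball x0 ε | f ((g (y - x0)) 0) < (g (y - x0)) 1}) :
    TubeProp (frontier Ω ∩ ball x0 ε) := by
  refine ⟨5 * ε * Real.pi * (2 + K)^2, ε, by positivity, hε, fun r hr hrε => ?_⟩
  set N : ℕ := ⌈ε / r⌉₊ with hN
  have hN1 : ε / r ≤ N := Nat.le_ceil _
  have hN2 : (N:ℝ) < ε / r + 1 := Nat.ceil_lt_add_one (by positivity)
  let c : ℤ → E2 := fun j => x0 + g.symm (!₂[j * r, f (j * r)])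
  have hsub : thickening r (frontier Ω ∩ ball x0 ε) ⊆ ⋃ j ∈ Finset.Icc (-(N:ℤ)) N, ball (c j) ((2 + K) * r) := by
    intro x hx
    rw [mem_thickening_iff] at hx
    obtain ⟨y, ⟨hy, hyb⟩, hxy⟩ := hx
    have hg := frontier_graph hO hf.continuous h hy hyb
    set p := (g (y - x0)) 0 with hp
    have hpε : |p| < ε := by
      calc |p| ≤ ‖g (y - x0)‖ := coord_le _ _
        _ = ‖y - x0‖ := g.norm_map _
        _ < ε := by rwa [← dist_eq_norm]
    rw [mem_iUnion₂]
    have hfl1 := Int.floor_le (p / r)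
    have hfl2 := Int.lt_floor_add_one (p / r)
    have hpr : |p / r| < ε / r := by
      rw [abs_div, abs_of_pos hr]; gcongr
    rw [abs_lt] at hpr
    refine ⟨⌊p / r⌋, ?_, ?_⟩
    · rw [Finset.mem_Icc]
      constructor
      · rw [Int.le_floor]; push_cast; linarith
      · have : ((⌊p / r⌋ : ℤ) : ℝ) < N := by linarith
        exact_mod_cast this.le
    · set j : ℤ := ⌊p / r⌋
      rw [le_div_iff₀ hr] at hfl1
      rw [div_lt_iff₀ hr] at hfl2
      have hpj : |p - j * r| ≤ r := by rw [abs_le]; constructor <;> nlinarith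
      have hfj : |f p - f (j * r)| ≤ K * r := by
        have := hf.dist_le_mul p (j * r)
        rw [Real.dist_eq, Real.dist_eq] at this
        exact this.trans (by gcongr)
      have hyc : dist y (c j) ≤ (1 + K) * r := by
        have : y - c j = g.symm (g (y - x0) - !₂[j * r, f (j * r)]) := by
          simp [c, sub_sub]
        rw [dist_eq_norm, this, LinearIsometryEquiv.norm_map]
        refine (norm_le_coord _).trans ?_
        simp only [PiLp.sub_apply]
        rw [← hp, ← hg]
        simp
        linarith
      rw [mem_ball]
      have := dist_triangle x y (c j)
      linarith
  refine (measure_mono hsub).trans ((measure_biUnion_finset_le _ _).trans ?_)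
  simp only [EuclideanSpace.volume_ball_fin_two, Finset.sum_const, Int.card_Icc, nsmul_eq_mul]
  have e1 : (((N:ℤ) + 1 - (-(N:ℤ))).toNat : ℝ≥0∞) = ENNReal.ofReal (2 * N + 1) := by
    have : ((N:ℤ) + 1 - (-(N:ℤ))).toNat = 2 * N + 1 := by lia
    rw [this, ← ENNReal.ofReal_natCast]; push_cast; rfl
  rw [e1, ← ENNReal.ofReal_pow (by positivity), ← ENNReal.ofReal_mul (by positivity), ← ENNReal.ofReal_mul (by positivity)]
  apply ENNReal.ofReal_le_ofReal
  have h5 : (2 * N + 1 : ℝ) * r ≤ 5 * ε := by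
    have : (2 * N + 1 : ℝ) ≤ 2 * (ε / r) + 3 := by linarith
    calc (2 * N + 1 : ℝ) * r ≤ (2 * (ε / r) + 3) * r := by gcongr
      _ = 2 * ε + 3 * r := by field_simp
      _ ≤ 5 * ε := by linarith
  calc (2 * (N:ℝ) + 1) * (((2 + K) * r)^2 * Real.pi) = ((2 * N + 1 : ℝ) * r) * (Real.pi * (2 + K)^2 * r) := by ring
    _ ≤ (5 * ε) * (Real.pi * (2 + K)^2 * r) := by gcongr
    _ = _ := by ring

lemma tube_bound {Ω : Set E2} (hO : IsOpen Ω) (hb : IsBounded Ω) (hL : IsLipschitzDomain Ω) :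
    TubeProp (frontier Ω) := by
  have hcpt : IsCompact (frontier Ω) :=
    (isCompact_of_isClosed_isBounded isClosed_closure hb.closure).of_isClosed_subset isClosed_frontier frontier_subset_closure
  refine hcpt.induction_on (p := TubeProp) ⟨0, 1, le_rfl, one_pos, fun r _ _ => by simp⟩ ?_ ?_ ?_
  · rintro s t hst ⟨C, r0, h1, h2, h3⟩
    exact ⟨C, r0, h1, h2, fun r a b => (measure_mono (thickening_subset_of_subset _ hst)).trans (h3 r a b)⟩
  · rintro s t ⟨C, r0, h1, h2, h3⟩ ⟨C', r0', h1', h2', h3'⟩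
    refine ⟨C + C', min r0 r0', by positivity, by positivity, fun r a b => ?_⟩
    rw [thickening_union, add_mul, ENNReal.ofReal_add (by positivity) (by positivity)]
    exact (measure_union_le _ _).trans (add_le_add (h3 r a (b.trans_le (min_le_left _ _))) (h3' r a (b.trans_le (min_le_right _ _))))
  · intro x hx
    obtain ⟨g, f, K, ε, hε, hf, h⟩ := hL x hx
    refine ⟨_, ?_, tube_local hO hε hf h⟩
    exact inter_mem self_mem_nhdsWithin (mem_nhdsWithin_of_mem_nhds (ball_mem_nhds _ hε))

def DensProp (Ω S : Set E2) : Prop :=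
  ∃ c r0 : ℝ, 0 < c ∧ 0 < r0 ∧ ∀ y ∈ S, ∀ r, 0 < r → r < r0 → ENNReal.ofReal (c * r^2) ≤ volume (ball y r \ Ω)

lemma dens_local {Ω : Set E2} (hO : IsOpen Ω) {x0 : E2} {g : E2 ≃ₗᵢ[ℝ] E2} {f : ℝ → ℝ} {K : NNReal} {ε : ℝ}
    (hε : 0 < ε) (hf : LipschitzWith K f)
    (h : Ω ∩ ball x0 ε = {y ∈ ball x0 ε | f ((g (y - x0)) 0) < (g (y - x0)) 1}) :
    DensProp Ω (frontier Ω ∩ ball x0 (ε/2)) := by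
  refine ⟨Real.pi / (2 * (K + 2))^2, ε / 2, by positivity, by positivity, fun y hy r hr hrε => ?_⟩
  have hyb : y ∈ ball x0 ε := ball_subset_ball (by linarith) hy.2
  have hg := frontier_graph hO hf.continuous h hy.1 hyb
  set ρ := r / (2 * (K + 2)) with hρ
  have hK : (0:ℝ) ≤ K := K.2
  have hρ0 : 0 < ρ := by positivity
  have hρ1 : (K + 2) * ρ = r / 2 := by rw [hρ]; field_simp
  set c : E2 := y - g.symm (EuclideanSpace.single 1 (r/2)) with hc
  have hsub : ball c ρ ⊆ ball y r \ Ω := by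
    intro x hx
    rw [mem_ball] at hx
    have hcy : dist c y = r / 2 := by
      rw [dist_eq_norm, hc]
      simp [abs_of_pos hr]
    have hxy : dist x y < r := by
      have := dist_triangle x c y
      nlinarith
    refine ⟨hxy, fun hxΩ => ?_⟩
    have hxb : x ∈ ball x0 ε := by
      have := dist_triangle x y x0
      have := mem_ball.1 hy.2
      rw [mem_ball]; linarith
    have hx2 : x ∈ Ω ∩ ball x0 ε := ⟨hxΩ, hxb⟩
    rw [h] at hx2
    have hlt := hx2.2
    have hd : g (x - x0) = g (x - c) + g (y - x0) - EuclideanSpace.single 1 (r/2) := by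
      have : x - x0 = (x - c) + (y - x0) - g.symm (EuclideanSpace.single 1 (r/2)) := by
        rw [hc]; abel
      rw [this]; simp
    have hn : ‖g (x - c)‖ < ρ := by rw [g.norm_map, ← dist_eq_norm]; exact hx
    have h0 := (coord_le (g (x - c)) 0).trans_lt hn
    have h1 := (coord_le (g (x - c)) 1).trans_lt hn
    have e0 : (g (x - x0)) 0 = (g (x - c)) 0 + (g (y - x0)) 0 := by rw [hd]; simp
    have e1 : (g (x - x0)) 1 = (g (x - c)) 1 + (g (y - x0)) 1 - r / 2 := by rw [hd]; simp
    have hl := hf.dist_le_mul ((g (x - x0)) 0) ((g (y - x0)) 0)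
    rw [Real.dist_eq, Real.dist_eq, e0, add_sub_cancel_right] at hl
    rw [e0, e1, ← hg] at hlt
    have hl2 := (abs_le.1 hl).1
    have : K * |(g (x - c)) 0| ≤ K * ρ := by gcongr
    have := (abs_lt.1 h1).2
    linarith
  refine le_trans (le_of_eq ?_) (measure_mono hsub)
  rw [EuclideanSpace.volume_ball_fin_two, ← ENNReal.ofReal_pow (by positivity), ← ENNReal.ofReal_mul (by positivity)]
  congr 1
  rw [hρ]; field_simp

lemma dens_bound {Ω : Set E2} (hO : IsOpen Ω) (hb : IsBounded Ω) (hL : IsLipschitzDomain Ω) :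
    DensProp Ω Ωᶜ := by
  have hcpt : IsCompact (frontier Ω) :=
    (isCompact_of_isClosed_isBounded isClosed_closure hb.closure).of_isClosed_subset isClosed_frontier frontier_subset_closure
  have hF : DensProp Ω (frontier Ω) := by
    refine hcpt.induction_on (p := DensProp Ω) ⟨1, 1, one_pos, one_pos, fun r hr => by simp at hr⟩ ?_ ?_ ?_
    · rintro s t hst ⟨C, r0, h1, h2, h3⟩
      exact ⟨C, r0, h1, h2, fun y hy => h3 y (hst hy)⟩
    · rintro s t ⟨C, r0, h1, h2, h3⟩ ⟨C', r0', h1', h2', h3'⟩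
      refine ⟨min C C', min r0 r0', by positivity, by positivity, fun y hy r a b => ?_⟩
      rcases hy with hy | hy
      · refine le_trans (ENNReal.ofReal_le_ofReal ?_) (h3 y hy r a (b.trans_le (min_le_left _ _)))
        gcongr; exact min_le_left _ _
      · refine le_trans (ENNReal.ofReal_le_ofReal ?_) (h3' y hy r a (b.trans_le (min_le_right _ _)))
        gcongr; exact min_le_right _ _
    · intro x hx
      obtain ⟨g, f, K, ε, hε, hf, h⟩ := hL x hx
      refine ⟨_, ?_, dens_local hO hε hf h⟩
      exact inter_mem self_mem_nhdsWithin (mem_nhdsWithin_of_mem_nhds (ball_mem_nhds _ (by positivity)))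
  obtain ⟨c, r0, hc, hr0, H⟩ := hF
  refine ⟨min (c / 4) (Real.pi / 4), r0, by positivity, hr0, fun x hx r hr hrr => ?_⟩
  by_cases hne : (ball x (r/2) ∩ frontier Ω).Nonempty
  · obtain ⟨y, hy1, hy2⟩ := hne
    refine le_trans (ENNReal.ofReal_le_ofReal ?_) ((H y hy2 (r/2) (by positivity) (by linarith)).trans (measure_mono ?_))
    · have : min (c / 4) (Real.pi / 4) ≤ c / 4 := min_le_left _ _
      nlinarith [sq_nonneg r]
    · refine sdiff_subset_sdiff_left (ball_subset_ball' ?_)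
      rw [mem_ball] at hy1; linarith
  · have hsub : ball x (r/2) ⊆ ball x r \ Ω := by
      intro z hz
      refine ⟨ball_subset_ball (by linarith) hz, fun hzΩ => hne ?_⟩
      have := (convex_ball x (r/2)).isPreconnected
      exact preconn_frontier hO this ⟨z, hz, hzΩ⟩ ⟨x, mem_ball_self (by positivity), hx⟩
    refine le_trans ?_ (measure_mono hsub)
    rw [EuclideanSpace.volume_ball_fin_two, ← ENNReal.ofReal_pow (by positivity), ← ENNReal.ofReal_mul (by positivity)]
    apply ENNReal.ofReal_le_ofReal
    have : min (c / 4) (Real.pi / 4) ≤ Real.pi / 4 := min_le_right _ _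
    nlinarith [sq_nonneg r]

lemma gain_sub_tube {Ω : Set E2} (hO : IsOpen Ω) (v : E2) {r : ℝ} (hv : ‖v‖ < r) :
    gainSet Ω v ⊆ thickening r (frontier Ω) := by
  rintro x ⟨hx, hxv⟩
  have hseg : IsPreconnected (segment ℝ x (x + v)) := (convex_segment _ _).isPreconnected
  obtain ⟨y, hy, hyf⟩ := preconn_frontier hO hseg ⟨x + v, right_mem_segment _ _ _, hxv⟩ ⟨x, left_mem_segment _ _ _, hx⟩
  rw [mem_thickening_iff]
  refine ⟨y, hyf, ?_⟩
  have h2 := dist_add_dist_of_mem_segment hy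
  have h1 : dist x (x + v) = ‖v‖ := by simp [dist_eq_norm]
  have h3 : 0 ≤ dist y (x + v) := dist_nonneg
  linarith

lemma lip_bddAbove {Ω : Set E2} (hO : IsOpen Ω) (hb : IsBounded Ω) (hL : IsLipschitzDomain Ω) :
    BddAbove (perimSet Ω) := by
  have hfin : volume Ω ≠ ⊤ := hb.measure_lt_top.ne
  obtain ⟨C, r0, hC0, hr0, H⟩ := tube_bound hO hb hL
  refine bddAbove_of_trans (C := 4 * C) (r0 := r0 / 2) hfin (by positivity) fun i τ hτ hτr ψ h1 h2 h3 => ?_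
  set v : E2 := τ • EuclideanSpace.single i 1 with hv
  have hvn : ‖v‖ = τ := by simp [hv, norm_smul, abs_of_pos hτ]
  obtain ⟨B, mB, sB, dB, vB, HB⟩ := trans_diff hO.measurableSet hfin v
  have e := HB ψ h1.continuous h3
  have hg : volume.real (gainSet Ω v) ≤ C * (2 * τ) := by
    refine ENNReal.toReal_le_of_le_ofReal (by positivity) ?_
    exact (measure_mono (gain_sub_tube hO v (r := 2 * τ) (by linarith))).trans (H _ (by positivity) (by linarith))
  have a1 : |∫ x in gainSet Ω v, ψ x| ≤ 1 * volume.real (gainSet Ω v) := by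
    rw [← Real.norm_eq_abs]
    exact norm_setIntegral_le_of_norm_le_const (gainSet_fin hfin v).lt_top fun x _ => h3 x
  have a2 : |∫ x in B, ψ x| ≤ 1 * volume.real B := by
    rw [← Real.norm_eq_abs]
    exact norm_setIntegral_le_of_norm_le_const (measure_ne_top_of_subset sB hfin).lt_top fun x _ => h3 x
  rw [abs_le] at a1 a2
  linarith [a1.1, a2.2]

lemma torsion_ge {Ω : Set E2} (hT : 0 < torsion Ω) {u : E2 → ℝ}
    (hu : ContDiff ℝ 1 u) (hc : HasCompactSupport u) (hs : tsupport u ⊆ Ω) :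
    (∫ x in Ω, u x)^2 ≤ torsion Ω * ∫ x in Ω, ‖fderiv ℝ u x‖^2 := by
  have hfc : Continuous (fderiv ℝ u) := hu.continuous_fderiv (by norm_num)
  have hnn : 0 ≤ ∫ x in Ω, ‖fderiv ℝ u x‖^2 := integral_nonneg fun x => by positivity
  have hfs : HasCompactSupport fun x => ‖fderiv ℝ u x‖^2 :=
    (hc.fderiv (𝕜 := ℝ)).comp_left (g := fun L => ‖L‖^2) (by simp)
  have hIntegr : Integrable fun x => ‖fderiv ℝ u x‖^2 :=
    Continuous.integrable_of_hasCompactSupport (by fun_prop) hfs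
  by_cases h0 : (∫ x in Ω, ‖fderiv ℝ u x‖^2) = 0
  · have hsupp : ∀ x, x ∉ Ω → fderiv ℝ u x = 0 := fun x hx => by
      have : x ∉ tsupport (fderiv ℝ u) := fun h => hx (hs (tsupport_fderiv_subset ℝ h))
      exact image_eq_zero_of_notMem_tsupport this
    have h1 : ∫ x, ‖fderiv ℝ u x‖^2 = 0 := by
      rw [← h0, setIntegral_eq_integral_of_forall_compl_eq_zero]
      intro x hx; simp [hsupp x hx]
    rw [integral_eq_zero_iff_of_nonneg (fun x => by positivity) hIntegr] at h1
    have h2 : (fun x => ‖fderiv ℝ u x‖^2) = 0 :=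
      (Continuous.ae_eq_iff_eq volume (by fun_prop) continuous_zero).1 h1
    have h3 : ∀ x, fderiv ℝ u x = 0 := fun x => by
      have := congrFun h2 x
      simpa using this
    have hconst := is_const_of_fderiv_eq_zero (hu.differentiable (by norm_num)) h3
    have : ∃ x, u x = 0 := by
      obtain ⟨x, hx⟩ : ∃ x, x ∉ tsupport u := by
        by_contra hcon
        push Not at hcon
        have : tsupport u = univ := eq_univ_of_forall hcon
        exact noncompact_univ E2 (this ▸ hc.isCompact)
      exact ⟨x, image_eq_zero_of_notMem_tsupport hx⟩
    obtain ⟨x0, hx0⟩ := this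
    have hz : ∀ x, u x = 0 := fun x => by rw [hconst x x0, hx0]
    simp [hz, h3]
  · have hpos := lt_of_le_of_ne hnn (Ne.symm h0)
    rw [← div_le_iff₀ hpos]
    refine le_csSup ?_ (Or.inr ⟨u, hu, hc, hs, h0, rfl⟩)
    by_contra hb
    have := Real.sSup_of_not_bddAbove hb
    unfold torsion at hT
    linarith

lemma moll {Ω : Set E2} (hO : IsOpen Ω) (hb : IsBounded Ω) {a ε : ℝ} (hε : 0 < ε) (hεa : 2 * ε < a) :
    ∃ u : E2 → ℝ, ContDiff ℝ 1 u ∧ HasCompactSupport u ∧ tsupport u ⊆ Ω ∧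
      (∀ x, ‖fderiv ℝ u x‖ ≤ max 0 (a - infDist x Ωᶜ) + 2 * ε) ∧
      (∀ x, ((a - 2 * ε)^2 - (max 0 (a - infDist x Ωᶜ))^2) / 2 - a * ε ≤ u x) := by
  have hne : Ωᶜ.Nonempty := by
    rw [nonempty_compl]; rintro rfl
    exact NormedSpace.unbounded_univ ℝ E2 hb
  set w : E2 → ℝ := fun x => infDist x Ωᶜ with hw
  have hwl : ∀ x y, w x ≤ w y + dist x y := fun x y => infDist_le_infDist_add_dist
  have hwc : Continuous w := continuous_infDist_pt _
  set y : E2 → ℝ := fun x => min (max 0 (a - w x)) (a - 2 * ε) with hy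
  have hyc : Continuous y := by fun_prop
  have hy0 : ∀ x, 0 ≤ y x := fun x => le_min (le_max_left _ _) (by linarith)
  have hyl : ∀ x z, y x ≤ y z + dist x z := by
    intro x z
    have h1 := hwl z x
    rw [dist_comm] at h1
    have d := dist_nonneg (x := x) (y := z)
    simp only [hy]
    rw [← min_add_add_right, ← max_add_add_right]
    apply min_le_min _ (by linarith)
    exact max_le_max (by linarith) (by linarith)
  have hya : ∀ x, y x ≤ a - 2 * ε := fun x => min_le_right _ _
  set u0 : E2 → ℝ := fun x => ((a - 2 * ε)^2 - (y x)^2) / 2 with hu0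
  have hu0c : Continuous u0 := by fun_prop
  have hu0l : ∀ x z L, y x ≤ L → y z ≤ L → |u0 x - u0 z| ≤ L * dist x z := by
    intro x z L hx hz
    have h1 := hyl x z
    have h2 := hyl z x
    rw [dist_comm z x] at h2
    have e : u0 x - u0 z = (y z - y x) * ((y x + y z) / 2) := by simp only [hu0]; ring
    rw [e, abs_mul, mul_comm]
    have h3 : |y z - y x| ≤ dist x z := by rw [abs_le]; constructor <;> linarith
    have h4 : |(y x + y z) / 2| ≤ L := by
      rw [abs_of_nonneg (by linarith [hy0 x, hy0 z])]; linarith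
    exact mul_le_mul h4 h3 (abs_nonneg _) ((hy0 x).trans hx)
  let φ : ContDiffBump (0 : E2) := ⟨ε / 2, ε, by positivity, by linarith⟩
  have hφ : φ.rOut = ε := rfl
  set u : E2 → ℝ := convolution (φ.normed volume) u0 (ContinuousLinearMap.lsmul ℝ ℝ) volume with hu
  have huval : ∀ x, u x = ∫ t, φ.normed volume t * u0 (x - t) := fun x => by
    rw [hu, convolution_def]; rfl
  have hsm : ContDiff ℝ 1 u :=
    φ.hasCompactSupport_normed.contDiff_convolution_left _ φ.contDiff_normed hu0c.locallyIntegrable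
  have hz : ∀ x, w x < ε → u x = 0 := by
    intro x hx
    have hx0 : ∀ z, w z < 2 * ε → u0 z = 0 := fun z hz => by
      have : y z = a - 2 * ε := by
        simp only [hy]
        rw [max_eq_right (by linarith), min_eq_right (by linarith)]
      simp only [hu0, this]; ring
    have h1 := φ.normed_convolution_eq_right (μ := volume) (g := u0) (x₀ := x) (fun z hz => by
      rw [hx0 x (by linarith), hx0 z]
      rw [mem_ball, hφ] at hz
      linarith [hwl z x])
    have : u x = u0 x := h1
    rw [this, hx0 x (by linarith)]
  have hts : tsupport u ⊆ {x | ε ≤ w x} := by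
    refine closure_minimal (fun x hx => ?_) (isClosed_le continuous_const hwc)
    by_contra hcon
    exact hx (hz x (not_le.1 hcon))
  have htΩ : tsupport u ⊆ Ω := by
    intro x hx
    by_contra hcon
    have h1 : w x = 0 := infDist_zero_of_mem hcon
    have h2 : ε ≤ w x := hts hx
    linarith
  refine ⟨u, hsm, ?_, htΩ, ?_, ?_⟩
  · exact isCompact_of_isClosed_isBounded (isClosed_tsupport u) (hb.subset htΩ)
  · intro x
    refine norm_fderiv_le_of_lip' ℝ (by positivity) ?_
    filter_upwards [ball_mem_nhds x hε] with z hz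
    rw [mem_ball] at hz
    have hi : ∀ x, Integrable fun t => φ.normed volume t * u0 (x - t) := fun x => by
      refine Continuous.integrable_of_hasCompactSupport ?_ (φ.hasCompactSupport_normed.mul_right)
      exact φ.continuous_normed.mul (hu0c.comp (by fun_prop))
    rw [huval, huval, ← integral_sub (hi z) (hi x)]
    set L := max 0 (a - w x) + 2 * ε
    have : ‖∫ t, (φ.normed volume t * u0 (z - t) - φ.normed volume t * u0 (x - t))‖ ≤ ∫ t, φ.normed volume t * (L * ‖z - x‖) := by
      refine norm_integral_le_of_norm_le (φ.integrable_normed.mul_const _) (Eventually.of_forall fun t => ?_)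
      rw [← mul_sub, norm_mul, Real.norm_of_nonneg (φ.nonneg_normed t)]
      by_cases ht : t ∈ ball (0:E2) ε
      · refine mul_le_mul_of_nonneg_left ?_ (φ.nonneg_normed t)
        rw [mem_ball_zero_iff] at ht
        have hyx : y x ≤ max 0 (a - w x) := min_le_left _ _
        have d1 : dist (z - t) x ≤ 2 * ε := by
          rw [dist_eq_norm, show z - t - x = (z - x) - t by abel]
          refine (norm_sub_le _ _).trans ?_
          rw [← dist_eq_norm]; linarith
        have d2 : dist (x - t) x ≤ 2 * ε := by
          rw [dist_eq_norm, show x - t - x = - t by abel, norm_neg]; linarith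
        have := hu0l (z - t) (x - t) L (by linarith [hyl (z - t) x]) (by linarith [hyl (x - t) x])
        rwa [dist_sub_right, dist_eq_norm] at this
      · have : φ.normed volume t = 0 := by
          have h2 := φ.support_normed_eq (μ := volume)
          rw [hφ] at h2
          rw [← h2] at ht
          exact Function.notMem_support.1 ht
        simp [this]
    refine this.trans (le_of_eq ?_)
    rw [integral_mul_const, φ.integral_normed, one_mul]
  · intro x
    have h1 := φ.dist_normed_convolution_le (μ := volume) (g := u0) (x₀ := x) (ε := a * ε) hu0c.aestronglyMeasurable (fun z hz => by
      rw [mem_ball, hφ] at hz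
      rw [Real.dist_eq]
      refine (hu0l z x a (by linarith [hya z]) (by linarith [hya x])).trans ?_
      gcongr
      linarith)
    have h2 : |u x - u0 x| ≤ a * ε := h1
    have h3 : (y x)^2 ≤ (max 0 (a - w x))^2 := by
      have : y x ≤ max 0 (a - w x) := min_le_left _ _
      exact pow_le_pow_left₀ (hy0 x) this 2
    have h4 := (abs_le.1 h2).1
    have h5 : u0 x = ((a - 2 * ε)^2 - (y x)^2) / 2 := rfl
    linarith

lemma layer {Ω : Set E2} (hfin : volume Ω ≠ ⊤) {a M : ℝ} (ha : 0 < a) (hM : 0 ≤ M)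
    (hcol : ∀ t, 0 < t → t ≤ a → volume.real {x ∈ Ω | infDist x Ωᶜ < t} ≤ M * t) :
    ∫ x in Ω, (max 0 (a - infDist x Ωᶜ))^2 ≤ M * a^3 / 3 := by
  have hc : Continuous fun x : E2 => max 0 (a - infDist x Ωᶜ) := by
    have := continuous_infDist_pt (Ωᶜ)
    fun_prop
  have key := lintegral_comp_eq_lintegral_meas_lt_mul (volume.restrict Ω) (f := fun x => max 0 (a - infDist x Ωᶜ))
    (g := fun t => 2 * t) (Eventually.of_forall fun x => le_max_left _ _) hc.measurable.aemeasurable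
    (fun t _ => (by fun_prop : Continuous fun t : ℝ => 2 * t).intervalIntegrable _ _)
    ((ae_restrict_mem measurableSet_Ioi).mono fun t ht => by have : 0 < t := ht; positivity)
  rw [integral_eq_lintegral_of_nonneg_ae (Eventually.of_forall fun x => by positivity) (by fun_prop)]
  refine ENNReal.toReal_le_of_le_ofReal (by positivity) ?_
  have e1 : ∀ x : ℝ, ∫ t in (0:ℝ)..x, 2 * t = x^2 := fun x => by
    rw [intervalIntegral.integral_const_mul, integral_id]; ring
  simp only [e1] at key
  rw [key]
  have hb : ∀ t ∈ Ioi (0:ℝ), (volume.restrict Ω) {x | t < max 0 (a - infDist x Ωᶜ)} * ENNReal.ofReal (2 * t)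
      ≤ (Ioc 0 a).indicator (fun t => ENNReal.ofReal (M * (a - t) * (2 * t))) t := by
    intro t ht
    have ht0 : 0 < t := ht
    have hset : (volume.restrict Ω) {x | t < max 0 (a - infDist x Ωᶜ)} = volume {x ∈ Ω | infDist x Ωᶜ < a - t} := by
      rw [Measure.restrict_apply (measurableSet_lt measurable_const hc.measurable)]
      congr 1; ext x
      simp only [mem_inter_iff, mem_ofPred_eq, lt_max_iff, not_lt.2 ht0.le, false_or]
      rw [and_comm]; exact and_congr_right fun _ => by constructor <;> intro h <;> linarith
    rw [hset]
    by_cases hta : t < a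
    · have hat : 0 ≤ a - t := by linarith
      rw [indicator_of_mem (show t ∈ Ioc 0 a from ⟨ht0, hta.le⟩), ENNReal.ofReal_mul (p := M * (a - t)) (by positivity)]
      gcongr
      have h2 := hcol (a - t) (by linarith) (by linarith)
      rw [ENNReal.le_ofReal_iff_toReal_le _ (by positivity)]
      · exact h2
      · have hss : {x | x ∈ Ω ∧ infDist x Ωᶜ < a - t} ⊆ Ω := fun x hx => hx.1
        exact measure_ne_top_of_subset hss hfin
    · have : {x | x ∈ Ω ∧ infDist x Ωᶜ < a - t} = ∅ := by
        ext x
        simp only [mem_ofPred_eq, mem_empty_iff_false, iff_false, not_and, not_lt]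
        intro _
        have : 0 ≤ infDist x Ωᶜ := infDist_nonneg
        linarith
      rw [this]; simp
  refine (setLIntegral_mono' measurableSet_Ioi hb).trans ?_
  rw [lintegral_indicator measurableSet_Ioc, Measure.restrict_restrict measurableSet_Ioc,
    inter_eq_left.2 (fun t ht => ht.1)]
  rw [← ofReal_integral_eq_lintegral_ofReal]
  · apply ENNReal.ofReal_le_ofReal
    rw [← intervalIntegral.integral_of_le ha.le]
    have : ∫ t in (0:ℝ)..a, M * (a - t) * (2 * t) = M * a^3 / 3 := by
      have : ∀ t : ℝ, M * (a - t) * (2 * t) = (2 * M * a) * t - 2 * M * t^2 := fun t => by ring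
      simp only [this]
      rw [intervalIntegral.integral_sub (Continuous.intervalIntegrable (by fun_prop) _ _) (Continuous.intervalIntegrable (by fun_prop) _ _)]
      rw [intervalIntegral.integral_const_mul, intervalIntegral.integral_const_mul, integral_id, integral_pow]
      norm_num; ring
    exact this.le
  · exact ((by fun_prop : Continuous fun t : ℝ => M * (a - t) * (2 * t)).integrableOn_Icc (a := 0) (b := a)).mono_set Ioc_subset_Icc_self
  · refine (ae_restrict_mem measurableSet_Ioc).mono fun t ht => ?_
    have := ht.1
    have : 0 ≤ a - t := by linarith [ht.2]
    show 0 ≤ M * (a - t) * (2 * t)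
    positivity

lemma torsion_lower {Ω : Set E2} (hO : IsOpen Ω) (hb : IsBounded Ω) (hT : 0 < torsion Ω) {a M : ℝ}
    (ha : 0 < a) (hM : 0 < M) (hS : volume.real Ω = M * a)
    (hcol : ∀ t, 0 < t → t ≤ a → volume.real {x ∈ Ω | infDist x Ωᶜ < t} ≤ M * t) :
    M * a^3 / 3 ≤ torsion Ω := by
  have hfin : volume Ω ≠ ⊤ := hb.measure_lt_top.ne
  have hE := layer hfin ha hM.le hcol
  set E := ∫ x in Ω, (max 0 (a - infDist x Ωᶜ))^2 with hEd
  set S := volume.real Ω with hSd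
  set T := torsion Ω with hTd
  have : IsFiniteMeasure (volume.restrict Ω) := ⟨by simpa using hfin.lt_top⟩
  have hc : Continuous fun x : E2 => max 0 (a - infDist x Ωᶜ) := by
    have := continuous_infDist_pt (Ωᶜ)
    fun_prop
  have hbd : ∀ x : E2, max 0 (a - infDist x Ωᶜ) ≤ a := fun x => by
    have : 0 ≤ infDist x Ωᶜ := infDist_nonneg
    exact max_le ha.le (by linarith)
  have hi : IntegrableOn (fun x : E2 => (max 0 (a - infDist x Ωᶜ))^2) Ω := by
    refine Integrable.of_bound (C := a^2) (by fun_prop) (Eventually.of_forall fun x => ?_)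
    rw [Real.norm_of_nonneg (by positivity)]
    exact pow_le_pow_left₀ (le_max_left _ _) (hbd x) 2
  set X : ℝ → ℝ := fun ε => ((a - 2 * ε)^2 * S - E) / 2 - a * ε * S with hX
  set Y : ℝ → ℝ := fun ε => T * (E + (4 * ε * a + 4 * ε^2) * S) with hY
  have step : ∀ ε, 0 < ε → 2 * ε < a → 0 ≤ X ε → (X ε)^2 ≤ Y ε := by
    intro ε hε hεa hX0
    obtain ⟨u, u1, u2, u3, u4, u5⟩ := moll hO hb hε hεa
    have h1 := torsion_ge hT u1 u2 u3
    have h2 : X ε ≤ ∫ x in Ω, u x := by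
      have hui : IntegrableOn u Ω := (u1.continuous.integrable_of_hasCompactSupport u2).integrableOn
      have hfi : IntegrableOn (fun x : E2 => ((a - 2 * ε)^2 - (max 0 (a - infDist x Ωᶜ))^2) / 2 - a * ε) Ω :=
        (((integrable_const _).sub hi).div_const 2).sub (integrable_const _)
      have h3 := integral_mono hfi hui u5
      refine le_trans (le_of_eq ?_) h3
      have hi2 : IntegrableOn (fun x : E2 => ((a - 2 * ε)^2 - (max 0 (a - infDist x Ωᶜ))^2) / 2) Ω :=
        ((integrable_const _).sub hi).div_const 2
      rw [integral_sub hi2 (integrable_const _), integral_div,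
        integral_sub (integrable_const _) hi]
      simp [hX]
      ring
    have h3 : ∫ x in Ω, ‖fderiv ℝ u x‖^2 ≤ E + (4 * ε * a + 4 * ε^2) * S := by
      have hfc : Continuous (fderiv ℝ u) := u1.continuous_fderiv (by norm_num)
      have hfs : HasCompactSupport fun x => ‖fderiv ℝ u x‖^2 :=
        (u2.fderiv (𝕜 := ℝ)).comp_left (g := fun L => ‖L‖^2) (by simp)
      have hIntegr : Integrable fun x => ‖fderiv ℝ u x‖^2 :=
        Continuous.integrable_of_hasCompactSupport (by fun_prop) hfs
      have h4 := integral_mono (μ := volume.restrict Ω) hIntegr.integrableOn (hi.add (integrable_const (4 * ε * a + 4 * ε^2))) (fun x => by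
        show ‖fderiv ℝ u x‖^2 ≤ (max 0 (a - infDist x Ωᶜ))^2 + (4 * ε * a + 4 * ε^2)
        have h5 := u4 x
        have h6 := hbd x
        have h7 : 0 ≤ max 0 (a - infDist x Ωᶜ) := le_max_left _ _
        have h8 := pow_le_pow_left₀ (norm_nonneg _) h5 2
        nlinarith)
      refine h4.trans (le_of_eq ?_)
      simp only [Pi.add_apply]
      rw [integral_add hi (integrable_const _)]
      simp [hEd, hSd]
      ring
    calc (X ε)^2 ≤ (∫ x in Ω, u x)^2 := pow_le_pow_left₀ hX0 h2 2
      _ ≤ _ := h1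
      _ ≤ Y ε := by simp only [hY]; gcongr
  have hXc : Continuous X := by fun_prop
  have hYc : Continuous Y := by fun_prop
  have hX00 : M * a^3 / 3 ≤ X 0 := by
    simp only [hX]; rw [hS]; nlinarith
  have hpos : 0 < M * a^3 / 3 := by positivity
  have hev : ∀ᶠ ε in 𝓝[>] (0:ℝ), (X ε)^2 ≤ Y ε := by
    have e1 : ∀ᶠ ε in 𝓝[>] (0:ℝ), 0 < X ε :=
      nhdsWithin_le_nhds (hXc.continuousAt.eventually (lt_mem_nhds (by linarith : 0 < X 0)))
    filter_upwards [e1, Ioo_mem_nhdsGT (show (0:ℝ) < a / 2 by positivity)] with ε h1 h2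
    exact step ε h2.1 (by linarith [h2.2]) h1.le
  have hlim : (X 0)^2 ≤ Y 0 := by
    have t1 : Tendsto (fun ε => (X ε)^2) (𝓝[>] (0:ℝ)) (𝓝 ((X 0)^2)) :=
      ((hXc.pow 2).tendsto 0).mono_left nhdsWithin_le_nhds
    have t2 : Tendsto Y (𝓝[>] (0:ℝ)) (𝓝 (Y 0)) := (hYc.tendsto 0).mono_left nhdsWithin_le_nhds
    exact le_of_tendsto_of_tendsto t1 t2 hev
  have hY0 : Y 0 = T * E := by simp [hY]
  have h9 : (M * a^3 / 3)^2 ≤ T * (M * a^3 / 3) := by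
    calc (M * a^3 / 3)^2 ≤ (X 0)^2 := pow_le_pow_left₀ hpos.le hX00 2
      _ ≤ T * E := by rw [← hY0]; exact hlim
      _ ≤ _ := by gcongr
  rw [sq] at h9
  exact le_of_mul_le_mul_right h9 hpos

lemma Fq_identity (q P T S : ℝ) (hT : 0 < T) (hS : 0 < S) :
    P * T ^ q / S ^ (2 * q + 1 / 2) = P * T ^ ((1:ℝ)/2) / S ^ (2 * ((1:ℝ)/2) + 1 / 2) * (T / S ^ 2) ^ (q - 1/2) := by
  rw [Real.div_rpow hT.le (by positivity), ← Real.rpow_natCast S 2, ← Real.rpow_mul hS.le]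
  have e1 : T ^ q = T ^ ((1:ℝ)/2) * T ^ (q - 1/2) := by rw [← Real.rpow_add hT]; congr 1; ring
  have e2 : S ^ (2 * q + 1 / 2) = S ^ (2 * ((1:ℝ)/2) + 1 / 2) * S ^ (((2:ℕ):ℝ) * (q - 1/2)) := by
    rw [← Real.rpow_add hS]; congr 1; push_cast; ring
  rw [e1, e2]
  have := Real.rpow_pos_of_pos hS (2 * ((1:ℝ)/2) + 1 / 2)
  have := Real.rpow_pos_of_pos hS (((2:ℕ):ℝ) * (q - 1/2))
  field_simp

lemma final_num {q P T S k : ℝ} (hq : 0 < q) (hq2 : q ≤ 1/2) (hP : 0 < P) (hT : 0 < T) (hS : 0 < S) (hk : 2 ≤ k)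
    (hiso : 8 * S ≤ P^2) (hlow : S^3 / (3 * k^2 * P^2) ≤ T) :
    (8 * Real.pi) ^ ((1:ℝ)/2 - q) / (Real.sqrt 3 * k) ≤ P * T ^ q / S ^ (2 * q + 1 / 2) := by
  have hpi := Real.pi_pos
  set τ := 8 * Real.pi * T / S^2 with hτ
  have hτ0 : 0 < τ := by positivity
  have e : P * T ^ q / S ^ (2 * q + 1 / 2) = (P / √S) * τ ^ q / (8 * Real.pi) ^ q := by
    rw [hτ, Real.div_rpow (by positivity) (by positivity), Real.mul_rpow (by positivity) hT.le,
      ← Real.rpow_natCast S 2, ← Real.rpow_mul hS.le, Real.rpow_add hS, Real.sqrt_eq_rpow]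
    have := Real.rpow_pos_of_pos hS (2 * q)
    have := Real.rpow_pos_of_pos hS (1/2)
    have := Real.rpow_pos_of_pos (show 0 < 8 * Real.pi by positivity) q
    push_cast
    field_simp
  rw [e, Real.rpow_sub (by positivity), ← Real.sqrt_eq_rpow, div_right_comm]
  have := Real.rpow_pos_of_pos (show 0 < 8 * Real.pi by positivity) q
  gcongr
  have hsS : 0 < √S := Real.sqrt_pos.2 hS
  have hs3 : 0 < √3 := by positivity
  rcases le_total 1 τ with h1 | h1
  · have h2 : 1 ≤ τ ^ q := Real.one_le_rpow h1 hq.le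
    have h3 : √(8 * Real.pi) / (√3 * k) ≤ P / √S := by
      rw [div_le_div_iff₀ (by positivity) hsS]
      have a1 : √(8 * Real.pi) * √S ≤ √(12 * P^2) := by
        rw [← Real.sqrt_mul (by positivity)]
        apply Real.sqrt_le_sqrt
        nlinarith [Real.pi_le_four]
      have a2 : √(12 * P^2) = P * (√3 * 2) := by
        rw [show 12 * P^2 = (P * 2)^2 * 3 by ring, Real.sqrt_mul (by positivity), Real.sqrt_sq (by positivity)]; ring
      rw [a2] at a1
      exact a1.trans (by gcongr)
    calc _ ≤ P / √S * 1 := by rw [mul_one]; exact h3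
      _ ≤ _ := by gcongr
  · have h2 : √τ ≤ τ ^ q := by
      rw [Real.sqrt_eq_rpow]
      exact Real.rpow_le_rpow_of_exponent_ge hτ0 h1 hq2
    refine le_trans ?_ (mul_le_mul_of_nonneg_left h2 (by positivity))
    refine (pow_le_pow_iff_left₀ (by positivity) (by positivity) two_ne_zero).1 ?_
    rw [div_pow, mul_pow, mul_pow, div_pow, Real.sq_sqrt (by positivity), Real.sq_sqrt (by positivity), Real.sq_sqrt hS.le, Real.sq_sqrt hτ0.le, hτ]
    rw [div_le_iff₀ (by positivity)] at hlow ⊢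
    rw [show P ^ 2 / S * (8 * Real.pi * T / S ^ 2) * (3 * k ^ 2) = 8 * Real.pi * (T * (3 * k^2 * P^2)) / S^3 by field_simp]
    rw [le_div_iff₀ (by positivity)]
    gcongr

lemma final_bound {Ω : Set E2} (hO : IsOpen Ω) (hb : IsBounded Ω) (hvol : 0 < (volume Ω).toReal)
    (hT : 0 < torsion Ω) {q : ℝ} (hq : 0 < q) (hq2 : q ≤ 1/2) {k : ℕ} (hk : 1 < k) (hP0 : 0 ≤ perimeter Ω)
    (hiso : 8 * volume.real Ω ≤ (perimeter Ω)^2)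
    (hcol : ∀ t, 0 < t → volume.real {x ∈ Ω | infDist x Ωᶜ < t} ≤ √2 * perimeter Ω * t + 4 * k * t^2) :
    Fq q Ω ≥ (8 * Real.pi) ^ ((1:ℝ)/2 - q) / (Real.sqrt 3 * (k : ℝ)) := by
  set P := perimeter Ω with hPd
  have hS : 0 < volume.real Ω := hvol
  have hP : 0 < P := lt_of_le_of_ne hP0 (by rintro h; rw [← h] at hiso; norm_num at hiso; linarith)
  have hk2 : (2:ℝ) ≤ k := by exact_mod_cast hk
  unfold Fq
  change _ ≥ _
  refine final_num hq hq2 hP hT hS hk2 hiso ?_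
  set S := volume.real Ω with hSd
  have hk0 : (0:ℝ) < k := by linarith
  have := torsion_lower hO hb hT (a := S / (k * P)) (M := k * P) (by positivity) (by positivity) (by field_simp; rfl) (by
    intro t ht hta
    refine (hcol t ht).trans ?_
    rw [le_div_iff₀ (by positivity)] at hta
    have h2 : √2 ≤ 1.4143 := by rw [Real.sqrt_le_left (by norm_num)]; norm_num
    have h3 : 4 * k * t^2 ≤ P / 2 * t := by
      have : 8 * (t * (k * P)) ≤ P^2 := by linarith
      have : 8 * (t * k) ≤ P := by nlinarith
      nlinarith
    have h4 : √2 * P * t ≤ 1.4143 * P * t := by gcongr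
    have h5 : 2 * P * t ≤ k * P * t := by gcongr
    nlinarith [mul_pos hP ht])
  refine le_trans (le_of_eq ?_) this
  change S ^ 3 / (3 * k ^ 2 * P ^ 2) = _
  field_simp

/-! ### Discretization: cells and representatives -/

noncomputable def idx (h : ℝ) (x : E2) : ℤ × ℤ := (⌊x 0 / h⌋, ⌊x 1 / h⌋)

def ccell (h : ℝ) (z : ℤ × ℤ) : Set E2 :=
  {x | ((z.1:ℝ) * h ≤ x 0 ∧ x 0 ≤ (z.1 + 1) * h) ∧ ((z.2:ℝ) * h ≤ x 1 ∧ x 1 ≤ (z.2 + 1) * h)}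

lemma cont_coord (i : Fin 2) : Continuous fun x : E2 => x i := by fun_prop

lemma ccell_closed (h : ℝ) (z : ℤ × ℤ) : IsClosed (ccell h z) := by
  refine IsClosed.inter (IsClosed.inter ?_ ?_) (IsClosed.inter ?_ ?_)
  · exact isClosed_le continuous_const (cont_coord 0)
  · exact isClosed_le (cont_coord 0) continuous_const
  · exact isClosed_le continuous_const (cont_coord 1)
  · exact isClosed_le (cont_coord 1) continuous_const

lemma idx_eq {h : ℝ} (hh : 0 < h) {x : E2} {z : ℤ × ℤ} : idx h x = z ↔
    ((z.1:ℝ) * h ≤ x 0 ∧ x 0 < (z.1 + 1) * h) ∧ ((z.2:ℝ) * h ≤ x 1 ∧ x 1 < (z.2 + 1) * h) := by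
  unfold idx
  rw [Prod.ext_iff]
  simp only [Int.floor_eq_iff, le_div_iff₀ hh, div_lt_iff₀ hh]

lemma mem_ccell_idx {h : ℝ} (hh : 0 < h) (x : E2) : x ∈ ccell h (idx h x) := by
  obtain ⟨⟨a, b⟩, c, d⟩ := (idx_eq hh (x := x)).1 rfl
  exact ⟨⟨a, b.le⟩, c, d.le⟩

lemma ccell_adj {h : ℝ} (hh : 0 < h) {z w : ℤ × ℤ} {x : E2} (hz : x ∈ ccell h z) (hw : x ∈ ccell h w) :
    |z.1 - w.1| ≤ 1 ∧ |z.2 - w.2| ≤ 1 := by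
  have key : ∀ a b : ℤ, ∀ t : ℝ, (a:ℝ) * h ≤ t → t ≤ (b + 1) * h → a ≤ b + 1 := by
    intro a b t h1 h2
    have : (a:ℝ) ≤ b + 1 := le_of_mul_le_mul_right (h1.trans h2) hh
    exact_mod_cast this
  obtain ⟨⟨a, b⟩, c, d⟩ := hz
  obtain ⟨⟨a', b'⟩, c', d'⟩ := hw
  have e1 := key _ _ _ a b'
  have e2 := key _ _ _ a' b
  have e3 := key _ _ _ c d'
  have e4 := key _ _ _ c' d
  rw [abs_le, abs_le]
  omega

lemma ccell_bdd {h : ℝ} (z : ℤ × ℤ) : IsBounded (ccell h z) := by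
  rw [isBounded_iff_forall_norm_le]
  refine ⟨(|(z.1:ℝ) * h| + |((z.1:ℝ) + 1) * h|) + (|(z.2:ℝ) * h| + |((z.2:ℝ) + 1) * h|), ?_⟩
  rintro x ⟨⟨a, b⟩, c, d⟩
  refine (norm_le_coord x).trans (add_le_add ?_ ?_)
  · rw [abs_le]; constructor
    · linarith [neg_abs_le ((z.1:ℝ) * h), abs_nonneg (((z.1:ℝ) + 1) * h)]
    · linarith [le_abs_self (((z.1:ℝ) + 1) * h), abs_nonneg ((z.1:ℝ) * h)]
  · rw [abs_le]; constructor
    · linarith [neg_abs_le ((z.2:ℝ) * h), abs_nonneg (((z.2:ℝ) + 1) * h)]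
    · linarith [le_abs_self (((z.2:ℝ) + 1) * h), abs_nonneg ((z.2:ℝ) * h)]

lemma cellRel_symm (D : Finset (ℤ × ℤ)) {z w : ℤ × ℤ} (h : cellRel D z w) : cellRel D w z := by
  obtain ⟨a, b, c, d⟩ := h
  exact ⟨b, a, by rwa [abs_sub_comm], by rwa [abs_sub_comm]⟩

lemma rtg_symm {D : Finset (ℤ × ℤ)} {z w : ℤ × ℤ} (h : Relation.ReflTransGen (cellRel D) z w) :
    Relation.ReflTransGen (cellRel D) w z := by
  induction h with
  | refl => exact Relation.ReflTransGen.refl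
  | tail _ h2 ih => exact Relation.ReflTransGen.head (cellRel_symm D h2) ih

lemma path_line {D : Finset (ℤ × ℤ)} (a e : ℤ × ℤ) (he1 : |e.1| ≤ 1) (he2 : |e.2| ≤ 1) (n : ℕ)
    (h : ∀ i : ℕ, i ≤ n → (a.1 + i * e.1, a.2 + i * e.2) ∈ D) :
    Relation.ReflTransGen (cellRel D) a (a.1 + n * e.1, a.2 + n * e.2) := by
  induction n with
  | zero => simpa using Relation.ReflTransGen.refl
  | succ n ih =>
    refine Relation.ReflTransGen.tail (ih fun i hi => h i (by omega)) ⟨h n (by omega), h (n+1) le_rfl, ?_, ?_⟩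
    · push_cast
      rw [show a.1 + n * e.1 - (a.1 + (n + 1) * e.1) = -e.1 by ring, abs_neg]; exact he1
    · push_cast
      rw [show a.2 + n * e.2 - (a.2 + (n + 1) * e.2) = -e.2 by ring, abs_neg]; exact he2

lemma border_conn {D : Finset (ℤ × ℤ)} {lo : ℤ} {m : ℕ}
    (hbd : ∀ z ∈ cellBox lo m, (z.1 = lo ∨ z.1 = lo + m - 1 ∨ z.2 = lo ∨ z.2 = lo + m - 1) → z ∈ D)
    {z : ℤ × ℤ} (hz : z ∈ cellBox lo m) (hb : z.1 = lo ∨ z.1 = lo + m - 1 ∨ z.2 = lo ∨ z.2 = lo + m - 1) :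
    Relation.ReflTransGen (cellRel D) (lo, lo) z := by
  obtain ⟨x, y⟩ := z
  rw [mem_cellBox] at hz
  obtain ⟨⟨h1, h2⟩, h3, h4⟩ := hz
  simp only at h1 h2 h3 h4 hb
  obtain ⟨X, hX⟩ := Int.eq_ofNat_of_zero_le (sub_nonneg.2 h1)
  obtain ⟨Y, hY⟩ := Int.eq_ofNat_of_zero_le (sub_nonneg.2 h3)
  have hx : x = lo + X := by omega
  have hy : y = lo + Y := by omega
  subst hx hy
  have hh : ∀ b : ℤ, lo ≤ b → b < lo + m → (b = lo ∨ b = lo + m - 1) →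
      Relation.ReflTransGen (cellRel D) (lo, b) (lo + X, b) := by
    intro b hb1 hb2 hb3
    have := path_line (D := D) (lo, b) (1, 0) (by simp) (by simp) X ?_
    · simpa using this
    · intro i hi
      apply hbd
      · rw [mem_cellBox]; simp only; omega
      · simp only; omega
  have hv : ∀ b : ℤ, lo ≤ b → b < lo + m → (b = lo ∨ b = lo + m - 1) →
      Relation.ReflTransGen (cellRel D) (b, lo) (b, lo + Y) := by
    intro b hb1 hb2 hb3
    have := path_line (D := D) (b, lo) (0, 1) (by simp) (by simp) Y ?_
    · simpa using this
    · intro i hi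
      apply hbd
      · rw [mem_cellBox]; simp only; omega
      · simp only; omega
  rcases hb with hb | hb | hb | hb
  · have := hv lo le_rfl (by omega) (Or.inl rfl)
    rwa [hb]
  · exact (hh lo le_rfl (by omega) (Or.inl rfl)).trans (hv (lo + X) h1 h2 (Or.inr hb))
  · have := hh lo le_rfl (by omega) (Or.inl rfl)
    rwa [hb]
  · exact (hv lo le_rfl (by omega) (Or.inl rfl)).trans (hh (lo + Y) h3 h4 (Or.inr hb))

lemma reps {K : Set E2} {h : ℝ} (hh : 0 < h) {lo : ℤ} {m k : ℕ} (hm : 0 < m) {D : Finset (ℤ × ℤ)}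
    (hD : D ⊆ cellBox lo m)
    (hmeet : ∀ z ∈ cellBox lo m, (∃ x ∈ K, x ∈ ccell h z) → z ∈ D)
    (hreach : ∀ z ∈ D, ∃ z0 ∈ D, (∃ x ∈ K, x ∈ ccell h z0) ∧ Relation.ReflTransGen (cellRel D) z0 z)
    (hbd : ∀ z ∈ cellBox lo m, (z.1 = lo ∨ z.1 = lo + m - 1 ∨ z.2 = lo ∨ z.2 = lo + m - 1) → z ∈ D)
    (hk : nBddCompLe K k) : HasReps D (k + 1) := by
  classical
  obtain ⟨hfin, hcard⟩ := hk
  let r : Set E2 → ℤ × ℤ := fun C => if hC : C.Nonempty then idx h hC.some else (0, 0)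
  have hcorner : (lo, lo) ∈ D := hbd _ (by rw [mem_cellBox]; simp only; omega) (Or.inl rfl)
  refine ⟨insert (lo, lo) ((hfin.toFinset.image r).filter (· ∈ D)), ?_, ?_, ?_⟩
  · intro z hz
    rw [Finset.mem_insert, Finset.mem_filter] at hz
    rcases hz with rfl | hz
    · exact hcorner
    · exact hz.2
  · refine (Finset.card_insert_le _ _).trans (Nat.succ_le_succ ?_)
    refine (Finset.card_filter_le _ _).trans (Finset.card_image_le.trans ?_)
    rwa [← Set.ncard_eq_toFinset_card _ hfin]
  · intro z hz
    obtain ⟨z0, hz0, ⟨x, hxK, hx⟩, hpath⟩ := hreach z hz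
    let T : Finset (ℤ × ℤ) := D.filter fun w => Relation.ReflTransGen (cellRel D) z0 w
    have hT : ∀ w, w ∈ T ↔ w ∈ D ∧ Relation.ReflTransGen (cellRel D) z0 w := fun w => Finset.mem_filter
    have hTadj : ∀ w ∈ T, ∀ w' ∈ D, |w.1 - w'.1| ≤ 1 → |w.2 - w'.2| ≤ 1 → w' ∈ T := by
      intro w hw w' hw' h1 h2
      rw [hT] at hw ⊢
      exact ⟨hw', hw.2.tail ⟨hw.1, hw', h1, h2⟩⟩
    by_cases hbT : ∃ b ∈ T, b.1 = lo ∨ b.1 = lo + m - 1 ∨ b.2 = lo ∨ b.2 = lo + m - 1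
    · obtain ⟨b, hb, hbb⟩ := hbT
      rw [hT] at hb
      refine ⟨(lo, lo), Finset.mem_insert_self _ _, ?_⟩
      exact ((border_conn hbd (hD hb.1) hbb).trans (rtg_symm hb.2)).trans hpath
    · push Not at hbT
      have hTin : ∀ w ∈ T, lo < w.1 ∧ w.1 + 1 < lo + m ∧ lo < w.2 ∧ w.2 + 1 < lo + m := by
        intro w hw
        have h1 := hD ((hT w).1 hw).1
        rw [mem_cellBox] at h1
        obtain ⟨a, b, c, d⟩ := hbT w hw
        omega
      have hTstrict : ∀ w ∈ T, ∀ y ∈ ccell h w,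
          (lo:ℝ) * h < y 0 ∧ y 0 < (lo + m) * h ∧ (lo:ℝ) * h < y 1 ∧ y 1 < (lo + m) * h := by
        rintro w hw y ⟨⟨a, b⟩, c, d⟩
        obtain ⟨i1, i2, i3, i4⟩ := hTin w hw
        have i1 : (lo:ℝ) < w.1 := by exact_mod_cast i1
        have i2 : (w.1:ℝ) + 1 < lo + m := by exact_mod_cast i2
        have i3 : (lo:ℝ) < w.2 := by exact_mod_cast i3
        have i4 : (w.2:ℝ) + 1 < lo + m := by exact_mod_cast i4
        have := mul_lt_mul_of_pos_right i1 hh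
        have := mul_lt_mul_of_pos_right i2 hh
        have := mul_lt_mul_of_pos_right i3 hh
        have := mul_lt_mul_of_pos_right i4 hh
        refine ⟨by linarith, by linarith, by linarith, by linarith⟩
      let F : Set E2 := ⋃ w ∈ T, ccell h w
      let M : Finset (ℤ × ℤ) := (cellBox lo m).filter fun w => (∃ x ∈ K, x ∈ ccell h w) ∧ w ∉ T
      let O : Set E2 := {y | (lo:ℝ) * h < y 0 ∧ y 0 < (lo + m) * h ∧ (lo:ℝ) * h < y 1 ∧ y 1 < (lo + m) * h}
      let F' : Set E2 := (⋃ w ∈ M, ccell h w) ∪ Oᶜ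
      have hOo : IsOpen O := by
        refine IsOpen.inter ?_ (IsOpen.inter ?_ (IsOpen.inter ?_ ?_))
        · exact isOpen_lt continuous_const (cont_coord 0)
        · exact isOpen_lt (cont_coord 0) continuous_const
        · exact isOpen_lt continuous_const (cont_coord 1)
        · exact isOpen_lt (cont_coord 1) continuous_const
      have hFc : IsClosed F := isClosed_biUnion_finset fun w _ => ccell_closed h w
      have hF'c : IsClosed F' :=
        (isClosed_biUnion_finset fun w _ => ccell_closed h w).union hOo.isClosed_compl
      have hFmem : ∀ y, y ∈ F ↔ ∃ w ∈ T, y ∈ ccell h w := by intro y; simp [F]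
      have hdisj : ∀ y ∈ F, y ∉ F' := by
        intro y hy hy'
        obtain ⟨w, hw, hyw⟩ := (hFmem y).1 hy
        rcases hy' with hy' | hy'
        · simp only [mem_iUnion] at hy'
          obtain ⟨w', hw', hyw'⟩ := hy'
          obtain ⟨b1, b2, b3⟩ := Finset.mem_filter.1 hw'
          have := ccell_adj hh hyw hyw'
          exact b3 (hTadj w hw w' (hmeet w' b1 b2) this.1 this.2)
        · exact hy' (hTstrict w hw y hyw)
      have hcover : ∀ y ∈ K, y ∈ F ∪ F' := by
        intro y hy
        by_cases hB : idx h y ∈ cellBox lo m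
        · by_cases hyT : idx h y ∈ T
          · left; exact (hFmem y).2 ⟨_, hyT, mem_ccell_idx hh y⟩
          · right; left
            simp only [mem_iUnion]
            exact ⟨idx h y, Finset.mem_filter.2 ⟨hB, ⟨y, hy, mem_ccell_idx hh y⟩, hyT⟩, mem_ccell_idx hh y⟩
        · right; right
          rintro ⟨o1, o2, o3, o4⟩
          apply hB
          obtain ⟨⟨a, b⟩, c, d⟩ := (idx_eq hh (x := y)).1 rfl
          have q1 : (lo:ℝ) < (idx h y).1 + 1 := lt_of_mul_lt_mul_right (o1.trans b) hh.le
          have q2 : ((idx h y).1:ℝ) < lo + m := lt_of_mul_lt_mul_right (a.trans_lt o2) hh.le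
          have q3 : (lo:ℝ) < (idx h y).2 + 1 := lt_of_mul_lt_mul_right (o3.trans d) hh.le
          have q4 : ((idx h y).2:ℝ) < lo + m := lt_of_mul_lt_mul_right (c.trans_lt o4) hh.le
          have q1 : lo < (idx h y).1 + 1 := by exact_mod_cast q1
          have q2 : (idx h y).1 < lo + m := by exact_mod_cast q2
          have q3 : lo < (idx h y).2 + 1 := by exact_mod_cast q3
          have q4 : (idx h y).2 < lo + m := by exact_mod_cast q4
          rw [mem_cellBox]
          omega
      let C := connectedComponentIn K x
      have hCK : C ⊆ K := connectedComponentIn_subset K x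
      have hxC : x ∈ C := mem_connectedComponentIn hxK
      have hz0T : z0 ∈ T := (hT z0).2 ⟨hz0, Relation.ReflTransGen.refl⟩
      have hCF : C ⊆ F := by
        intro y hy
        rcases hcover y (hCK hy) with hyF | hyF'
        · exact hyF
        · exfalso
          have := isPreconnected_closed_iff.1 (isPreconnected_connectedComponentIn (F := K) (x := x)) F F' hFc hF'c
            (fun w hw => hcover w (hCK hw)) ⟨x, hxC, (hFmem x).2 ⟨z0, hz0T, hx⟩⟩ ⟨y, hy, hyF'⟩
          obtain ⟨w, _, hw1, hw2⟩ := this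
          exact hdisj w hw1 hw2
      have hCb : IsBounded C := by
        refine IsBounded.subset ?_ hCF
        exact (isBounded_biUnion_finset T).2 fun w _ => ccell_bdd w
      have hCmem : C ∈ boundedComponents K := ⟨x, hxK, rfl, hCb⟩
      have hCne : C.Nonempty := ⟨x, hxC⟩
      have hrC : r C = idx h hCne.some := dif_pos hCne
      have hyC := hCne.some_mem
      obtain ⟨w, hw, hyw⟩ := (hFmem _).1 (hCF hyC)
      have hadj := ccell_adj hh hyw (mem_ccell_idx hh hCne.some)
      have hrB : r C ∈ cellBox lo m := by
        have := hTin w hw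
        rw [hrC, mem_cellBox]
        obtain ⟨a1, a2⟩ := hadj
        rw [abs_le] at a1 a2
        omega
      have hrD : r C ∈ D := hmeet _ hrB ⟨_, hCK hyC, by rw [hrC]; exact mem_ccell_idx hh _⟩
      have hrT : r C ∈ T := hTadj w hw _ hrD (by rw [hrC]; exact hadj.1) (by rw [hrC]; exact hadj.2)
      refine ⟨r C, ?_, ?_⟩
      · refine Finset.mem_insert_of_mem (Finset.mem_filter.2 ⟨Finset.mem_image.2 ⟨C, ?_, rfl⟩, hrD⟩)
        exact hfin.mem_toFinset.2 hCmem
      · exact (rtg_symm ((hT _).1 hrT).2).trans hpath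

def dI : Fin 2 → ℤ × ℤ := ![(1, 0), (0, 1)]

lemma idx_shift {h : ℝ} (hh : 0 < h) (x : E2) (i : Fin 2) (N : ℕ) :
    idx h (x + ((N:ℝ) * h) • EuclideanSpace.single i (1:ℝ)) = idx h x + N • dI i := by
  have e : ∀ t : ℝ, (t + N * h) / h = t / h + N := fun t => by field_simp
  fin_cases i <;> simp [idx, dI, e]

noncomputable def nbr (z : ℤ × ℤ) : Finset (ℤ × ℤ) :=
  Finset.Icc (z.1 - 1) (z.1 + 1) ×ˢ Finset.Icc (z.2 - 1) (z.2 + 1)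

lemma mem_nbr {z w : ℤ × ℤ} : w ∈ nbr z ↔ (z.1 - 1 ≤ w.1 ∧ w.1 ≤ z.1 + 1) ∧ (z.2 - 1 ≤ w.2 ∧ w.2 ≤ z.2 + 1) := by
  simp [nbr]

lemma card_nbr (z : ℤ × ℤ) : (nbr z).card = 9 := by
  simp only [nbr, Finset.card_product, Int.card_Icc]
  rw [show z.1 + 1 + 1 - (z.1 - 1) = 3 by ring, show z.2 + 1 + 1 - (z.2 - 1) = 3 by ring]; rfl

def cell (h : ℝ) (z : ℤ × ℤ) : Set E2 := {x | idx h x = z}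
def block (h : ℝ) (z : ℤ × ℤ) : Set E2 := {x | idx h x ∈ nbr z}

lemma idx_meas (h : ℝ) : Measurable (idx h) := by
  unfold idx
  have h0 := (cont_coord 0).measurable
  have h1 := (cont_coord 1).measurable
  exact ((h0.div_const h).floor).prodMk ((h1.div_const h).floor)

lemma cell_meas (h : ℝ) (z : ℤ × ℤ) : MeasurableSet (cell h z) :=
  idx_meas h (measurableSet_singleton z)

lemma block_meas (h : ℝ) (z : ℤ × ℤ) : MeasurableSet (block h z) :=
  idx_meas h (Finset.measurableSet (nbr z))

lemma cell_vol {h : ℝ} (hh : 0 < h) (z : ℤ × ℤ) : volume (cell h z) = ENNReal.ofReal (h ^ 2) := by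
  have e : cell h z = (WithLp.ofLp : E2 → Fin 2 → ℝ) ⁻¹'
      (Set.univ.pi ![Ico ((z.1:ℝ) * h) ((z.1 + 1) * h), Ico ((z.2:ℝ) * h) ((z.2 + 1) * h)]) := by
    ext x
    simp only [cell, Set.mem_ofPred_eq, idx_eq hh, Set.mem_preimage, Set.mem_univ_pi, Fin.forall_fin_two]
    simp
  have hm := (PiLp.volume_preserving_ofLp (Fin 2))
  rw [e, hm.measure_preimage, volume_pi_pi]
  · simp only [Fin.prod_univ_two, Matrix.cons_val_zero, Matrix.cons_val_one, Real.volume_Ico]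
    rw [← ENNReal.ofReal_mul (by nlinarith)]
    congr 1; ring
  · refine (MeasurableSet.univ_pi fun i => ?_).nullMeasurableSet
    fin_cases i <;> exact measurableSet_Ico

lemma cell_volr {h : ℝ} (hh : 0 < h) (z : ℤ × ℤ) : volume.real (cell h z) = h ^ 2 := by
  rw [measureReal_def, cell_vol hh, ENNReal.toReal_ofReal (by positivity)]

lemma cells_real {S : Set E2} (hS : MeasurableSet S) {h : ℝ} (hh : 0 < h) (I : Finset (ℤ × ℤ)) :
    volume.real (S ∩ {x | idx h x ∈ I}) = ∑ w ∈ I, volume.real (S ∩ cell h w) := by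
  have e : S ∩ {x | idx h x ∈ I} = ⋃ w ∈ I, (S ∩ cell h w) := by
    ext x; simp [cell]
  rw [e]
  refine measureReal_biUnion_finset ?_ ?_ ?_
  · intro a _ b _ hab
    rw [Function.onFun, Set.disjoint_left]
    rintro x ⟨_, h1⟩ ⟨_, h2⟩
    exact hab (h1.symm.trans h2)
  · intro b _; exact hS.inter (cell_meas h b)
  · intro b _
    refine measure_ne_top_of_subset (inter_subset_right : S ∩ cell h b ⊆ cell h b) ?_
    rw [cell_vol hh]; exact ENNReal.ofReal_ne_top

lemma block_fin {h : ℝ} (hh : 0 < h) (z : ℤ × ℤ) : volume (block h z) ≠ ⊤ := by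
  have e : block h z = ⋃ w ∈ nbr z, cell h w := by
    ext x; simp [cell, block]
  rw [e]
  refine ((measure_biUnion_finset_le _ _).trans_lt ?_).ne
  refine ENNReal.sum_lt_top.2 fun w _ => ?_
  rw [cell_vol hh]; exact ENNReal.ofReal_lt_top

lemma block_volr {h : ℝ} (hh : 0 < h) (z : ℤ × ℤ) : volume.real (block h z) = 9 * h ^ 2 := by
  have := cells_real MeasurableSet.univ hh (nbr z)
  simp only [Set.univ_inter, cell_volr hh, Finset.sum_const, card_nbr] at this
  rw [block, this]; simp

/-- cells with index in a finite set -/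
lemma cells_le {S : Set E2} {h : ℝ} (hh : 0 < h) (I : Finset (ℤ × ℤ)) (hS : ∀ x ∈ S, idx h x ∈ I) :
    volume.real S ≤ h ^ 2 * I.card := by
  have e : S ⊆ ⋃ w ∈ I, cell h w := by
    intro x hx; simp only [mem_iUnion]; exact ⟨_, hS x hx, rfl⟩
  have hf : volume (⋃ w ∈ I, cell h w) ≠ ⊤ := by
    refine ((measure_biUnion_finset_le _ _).trans_lt ?_).ne
    refine ENNReal.sum_lt_top.2 fun w _ => ?_
    rw [cell_vol hh]; exact ENNReal.ofReal_lt_top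
  refine (measureReal_mono e hf).trans ((measureReal_biUnion_finset_le _ _).trans ?_)
  simp [cell_volr hh, mul_comm]

lemma block_sum_le {S : Set E2} (hS : MeasurableSet S) (hfin : volume S ≠ ⊤) {h : ℝ} (hh : 0 < h)
    (I : Finset (ℤ × ℤ)) (d : ℤ × ℤ) :
    ∑ z ∈ I, volume.real (S ∩ block h (z - d)) ≤ 9 * volume.real S := by
  have h1 : ∀ z : ℤ × ℤ, volume.real (S ∩ block h (z - d)) =
      ∑ e ∈ nbr 0, volume.real (S ∩ cell h (z - d + e)) := by
    intro z
    rw [block, cells_real hS hh]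
    symm
    refine Finset.sum_bij (fun e _ => z - d + e) ?_ ?_ ?_ ?_
    · intro e he
      rw [mem_nbr] at he ⊢
      simp only [Prod.fst_add, Prod.snd_add, Prod.fst_zero, Prod.snd_zero] at he ⊢
      omega
    · intro a _ b _ hab; exact add_left_cancel hab
    · intro w hw
      refine ⟨w - (z - d), ?_, by abel⟩
      rw [mem_nbr] at hw ⊢
      simp only [Prod.fst_sub, Prod.snd_sub, Prod.fst_zero, Prod.snd_zero] at hw ⊢
      omega
    · intro e _; rfl
  simp_rw [h1]
  rw [Finset.sum_comm]
  have h2 : ∀ e ∈ nbr 0, ∑ z ∈ I, volume.real (S ∩ cell h (z - d + e)) ≤ volume.real S := by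
    intro e _
    have : ∑ z ∈ I, volume.real (S ∩ cell h (z - d + e)) =
        ∑ w ∈ I.image (fun z => z - d + e), volume.real (S ∩ cell h w) := by
      rw [Finset.sum_image]
      intro a _ b _ hab; simpa using hab
    rw [this, ← cells_real hS hh]
    exact measureReal_mono inter_subset_left hfin
  refine (Finset.sum_le_sum h2).trans ?_
  simp [card_nbr]

noncomputable def avg (Ω : Set E2) (h : ℝ) (z : ℤ × ℤ) : ℝ := volume.real (Ω ∩ block h z) / (9 * h ^ 2)

lemma avg_nonneg (Ω : Set E2) (h : ℝ) (z : ℤ × ℤ) : 0 ≤ avg Ω h z := by unfold avg; positivity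

lemma avg_upper {Ω : Set E2} (hO : MeasurableSet Ω) (hfin : volume Ω ≠ ⊤) {h : ℝ} (hh : 0 < h)
    (I : Finset (ℤ × ℤ)) (i : Fin 2) :
    ∑ z ∈ I, max (avg Ω h z - avg Ω h (z - dI i)) 0 ≤
      volume.real (gainSet Ω (h • EuclideanSpace.single i (1:ℝ))) / h ^ 2 := by
  set v : E2 := h • EuclideanSpace.single i (1:ℝ) with hv
  have hG := gainSet_meas hO v
  have hGf := gainSet_fin hfin v
  have h1 : ∀ z, max (avg Ω h z - avg Ω h (z - dI i)) 0 ≤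
      volume.real (gainSet Ω v ∩ block h (z - dI i)) / (9 * h ^ 2) := by
    intro z
    refine max_le ?_ (by positivity)
    unfold avg
    rw [← sub_div]
    refine div_le_div_of_nonneg_right ?_ (by positivity)
    have e : volume.real (Ω ∩ block h z) = volume.real ((· + v) ⁻¹' (Ω ∩ block h z)) := by
      rw [measureReal_def, measureReal_def, measure_preimage_add_right]
    have hsub : (· + v) ⁻¹' (Ω ∩ block h z) ⊆
        (Ω ∩ block h (z - dI i)) ∪ (gainSet Ω v ∩ block h (z - dI i)) := by
      rintro x ⟨hx1, hx2⟩
      have hx3 : x ∈ block h (z - dI i) := by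
        have := idx_shift hh x i 1
        simp only [Nat.cast_one, one_mul, one_smul] at this
        simp only [block, Set.mem_ofPred_eq] at hx2 ⊢
        rw [hv, this, mem_nbr] at hx2
        rw [mem_nbr]
        simp only [Prod.fst_add, Prod.snd_add, Prod.fst_sub, Prod.snd_sub] at hx2 ⊢
        omega
      by_cases hx : x ∈ Ω
      · exact Or.inl ⟨hx, hx3⟩
      · exact Or.inr ⟨⟨hx, hx1⟩, hx3⟩
    have hfu : volume ((Ω ∩ block h (z - dI i)) ∪ (gainSet Ω v ∩ block h (z - dI i))) ≠ ⊤ := by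
      refine measure_ne_top_of_subset (?_ : _ ⊆ block h (z - dI i)) (block_fin hh _)
      exact union_subset inter_subset_right inter_subset_right
    have := (measureReal_mono hsub hfu).trans (measureReal_union_le _ _)
    linarith
  refine (Finset.sum_le_sum fun z _ => h1 z).trans ?_
  rw [← Finset.sum_div]
  have := block_sum_le hG hGf hh I (dI i)
  rw [div_le_div_iff₀ (by positivity) (by positivity)]
  nlinarith [sq_nonneg h]

lemma ind_int (a b : ℝ) : IntegrableOn ((Ico a b).indicator (fun _ => (1:ℝ))) (Ioo 0 1) volume ∧
    ∫ s in Ioo (0:ℝ) 1, (Ico a b).indicator (fun _ => (1:ℝ)) s ≤ max (b - a) 0 := by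
  have hi : Integrable ((Ico a b).indicator (fun _ => (1:ℝ))) volume := by
    rw [integrable_indicator_iff measurableSet_Ico]
    exact integrableOn_const (by simp)
  refine ⟨hi.integrableOn, ?_⟩
  refine (setIntegral_le_integral hi (ae_of_all _ fun s => ?_)).trans ?_
  · exact indicator_nonneg (fun _ _ => zero_le_one) s
  · rw [integral_indicator measurableSet_Ico]
    simp [Measure.real, Real.volume_Ico, ENNReal.toReal_ofReal']

lemma coarea_select {ι : Type*} (I : Finset ι) (α1 α2 β : ι → ℝ) {A B L c : ℝ} (hc : 0 < c) (hc1 : c < 1)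
    (hA : ∑ i ∈ I, (max (β i - α1 i) 0 + max (β i - α2 i) 0) ≤ A)
    (hL : ∀ s, 0 < s → s < 1 → L ≤ ((I.filter fun i => α1 i ≤ s ∧ s < β i).card : ℝ) +
      ((I.filter fun i => α2 i ≤ s ∧ s < β i).card : ℝ))
    (hB : A < c * B + (1 - c) * L) :
    ∃ s, 1 - c < s ∧ s < 1 ∧ ((I.filter fun i => α1 i ≤ s ∧ s < β i).card : ℝ) +
      ((I.filter fun i => α2 i ≤ s ∧ s < β i).card : ℝ) ≤ B := by
  by_contra hcon
  push Not at hcon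
  let f : ℝ → ℝ := fun s => ∑ i ∈ I, ((Ico (α1 i) (β i)).indicator (fun _ => (1:ℝ)) s +
    (Ico (α2 i) (β i)).indicator (fun _ => (1:ℝ)) s)
  have hf : ∀ s, f s = ((I.filter fun i => α1 i ≤ s ∧ s < β i).card : ℝ) +
      ((I.filter fun i => α2 i ≤ s ∧ s < β i).card : ℝ) := by
    intro s
    simp only [f, Finset.sum_add_distrib, Set.indicator_apply, Set.mem_Ico]
    simp only [Finset.sum_boole]
  have hfi : IntegrableOn f (Ioo 0 1) volume := by
    refine integrable_finsetSum _ fun i _ => ?_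
    exact (ind_int _ _).1.add (ind_int _ _).1
  have hfA : ∫ s in Ioo (0:ℝ) 1, f s ≤ A := by
    refine le_trans ?_ hA
    simp only [f]
    have hIntegr : ∀ i ∈ I, Integrable (fun s => (Ico (α1 i) (β i)).indicator (fun _ => (1:ℝ)) s +
        (Ico (α2 i) (β i)).indicator (fun _ => (1:ℝ)) s) (volume.restrict (Ioo 0 1)) :=
      fun i _ => (ind_int _ _).1.add (ind_int _ _).1
    rw [integral_finsetSum _ hIntegr]
    refine Finset.sum_le_sum fun i _ => ?_
    rw [integral_add (ind_int _ _).1 (ind_int _ _).1]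
    exact add_le_add (ind_int _ _).2 (ind_int _ _).2
  have hsplit : Ioo (0:ℝ) 1 = Ioc 0 (1 - c) ∪ Ioo (1 - c) 1 := by
    ext s; simp only [mem_Ioo, mem_union, mem_Ioc]
    constructor
    · rintro ⟨a, b⟩
      rcases le_or_gt s (1 - c) with h | h
      · exact Or.inl ⟨a, h⟩
      · exact Or.inr ⟨h, b⟩
    · rintro (⟨a, b⟩ | ⟨a, b⟩)
      · exact ⟨a, by linarith⟩
      · exact ⟨by linarith, b⟩
  have hi1 : IntegrableOn f (Ioc 0 (1 - c)) volume := hfi.mono_set (by rw [hsplit]; exact subset_union_left)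
  have hi2 : IntegrableOn f (Ioo (1 - c) 1) volume := hfi.mono_set (by rw [hsplit]; exact subset_union_right)
  rw [hsplit, setIntegral_union ?_ measurableSet_Ioo hi1 hi2] at hfA
  · have g1 := setIntegral_ge_of_const_le_real (f := f) (c := L) measurableSet_Ioc (by simp)
      (fun s (hs : s ∈ Ioc 0 (1 - c)) => by rw [hf]; exact hL s hs.1 (by linarith [hs.2])) hi1
    have g2 := setIntegral_ge_of_const_le_real (f := f) (c := B) measurableSet_Ioo (by simp)
      (fun s (hs : s ∈ Ioo (1 - c) 1) => by rw [hf]; exact (hcon s hs.1 hs.2).le) hi2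
    rw [Real.volume_real_Ioc_of_le (by linarith)] at g1
    rw [Real.volume_real_Ioo_of_le (by linarith)] at g2
    nlinarith
  · rw [Set.disjoint_left]
    rintro s ⟨_, h1⟩ ⟨h2, _⟩
    linarith

lemma block_sub_ball {h : ℝ} (hh : 0 < h) (x : E2) : block h (idx h x) ⊆ ball x (4 * h) := by
  intro y hy
  simp only [block, Set.mem_ofPred_eq, mem_nbr] at hy
  obtain ⟨⟨a, b⟩, c, d⟩ := (idx_eq hh (x := x)).1 rfl
  obtain ⟨⟨a', b'⟩, c', d'⟩ := (idx_eq hh (x := y)).1 rfl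
  obtain ⟨⟨e1, e2⟩, e3, e4⟩ := hy
  have e1 : ((idx h x).1:ℝ) - 1 ≤ (idx h y).1 := by exact_mod_cast e1
  have e2 : ((idx h y).1:ℝ) ≤ (idx h x).1 + 1 := by exact_mod_cast e2
  have e3 : ((idx h x).2:ℝ) - 1 ≤ (idx h y).2 := by exact_mod_cast e3
  have e4 : ((idx h y).2:ℝ) ≤ (idx h x).2 + 1 := by exact_mod_cast e4
  have f1 := mul_le_mul_of_nonneg_right e1 hh.le
  have f2 := mul_le_mul_of_nonneg_right e2 hh.le
  have f3 := mul_le_mul_of_nonneg_right e3 hh.le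
  have f4 := mul_le_mul_of_nonneg_right e4 hh.le
  rw [mem_ball, dist_eq_norm]
  refine (norm_le_coord (y - x)).trans_lt ?_
  have g1 : |(y - x) 0| < 2 * h := by
    rw [PiLp.sub_apply, abs_lt]; constructor <;> linarith
  have g2 : |(y - x) 1| < 2 * h := by
    rw [PiLp.sub_apply, abs_lt]; constructor <;> linarith
  linarith

lemma ball_sub_block {h : ℝ} (hh : 0 < h) {x : E2} {z : ℤ × ℤ} (hx : x ∈ ccell h z) : ball x h ⊆ block h z := by
  intro y hy
  rw [mem_ball, dist_eq_norm] at hy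
  have g1 := (coord_le (y - x) 0).trans_lt hy
  have g2 := (coord_le (y - x) 1).trans_lt hy
  rw [PiLp.sub_apply, abs_lt] at g1 g2
  obtain ⟨⟨a, b⟩, c, d⟩ := hx
  obtain ⟨⟨a', b'⟩, c', d'⟩ := (idx_eq hh (x := y)).1 rfl
  simp only [block, Set.mem_ofPred_eq, mem_nbr]
  have q1 : (z.1:ℝ) - 1 < (idx h y).1 + 1 := lt_of_mul_lt_mul_right (by linarith : _ * h < _ * h) hh.le
  have q2 : ((idx h y).1:ℝ) < z.1 + 1 + 1 := lt_of_mul_lt_mul_right (by linarith : _ * h < _ * h) hh.le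
  have q3 : (z.2:ℝ) - 1 < (idx h y).2 + 1 := lt_of_mul_lt_mul_right (by linarith : _ * h < _ * h) hh.le
  have q4 : ((idx h y).2:ℝ) < z.2 + 1 + 1 := lt_of_mul_lt_mul_right (by linarith : _ * h < _ * h) hh.le
  have q1 : z.1 - 1 < (idx h y).1 + 1 := by exact_mod_cast q1
  have q2 : (idx h y).1 < z.1 + 1 + 1 := by exact_mod_cast q2
  have q3 : z.2 - 1 < (idx h y).2 + 1 := by exact_mod_cast q3
  have q4 : (idx h y).2 < z.2 + 1 + 1 := by exact_mod_cast q4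
  omega

lemma avg_one {Ω : Set E2} (hO : IsOpen Ω) {h : ℝ} (hh : 0 < h) {x : E2} (hx : x ∈ Ω)
    (hT : x ∉ thickening (4 * h) (frontier Ω)) : avg Ω h (idx h x) = 1 := by
  have hs : block h (idx h x) ⊆ Ω := by
    intro y hy
    by_contra hyn
    obtain ⟨w, hw1, hw2⟩ := preconn_frontier hO (convex_ball x (4 * h)).isPreconnected
      ⟨x, mem_ball_self (by positivity), hx⟩ ⟨y, block_sub_ball hh x hy, hyn⟩
    exact hT (mem_thickening_iff.2 ⟨w, hw2, by rwa [dist_comm]⟩)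
  rw [avg, Set.inter_eq_right.2 hs, block_volr hh, div_self (by positivity)]

lemma avg_zero {Ω : Set E2} (hO : IsOpen Ω) {h : ℝ} (hh : 0 < h) {x : E2} (hx : x ∉ Ω)
    (hT : x ∉ thickening (4 * h) (frontier Ω)) : avg Ω h (idx h x) = 0 := by
  have hs : Ω ∩ block h (idx h x) = ∅ := by
    rw [Set.eq_empty_iff_forall_notMem]
    rintro y ⟨hyn, hy⟩
    obtain ⟨w, hw1, hw2⟩ := preconn_frontier hO (convex_ball x (4 * h)).isPreconnected
      ⟨y, block_sub_ball hh x hy, hyn⟩ ⟨x, mem_ball_self (by positivity), hx⟩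
    exact hT (mem_thickening_iff.2 ⟨w, hw2, by rwa [dist_comm]⟩)
  rw [avg, hs]; simp

lemma avg_dens {Ω : Set E2} (hO : IsOpen Ω) {h c : ℝ} (hh : 0 < h) {x : E2} {z : ℤ × ℤ}
    (hx : x ∈ ccell h z) (hd : ENNReal.ofReal (c * h ^ 2) ≤ volume (ball x h \ Ω)) :
    avg Ω h z ≤ 1 - c / 9 := by
  have hm : MeasurableSet (ball x h \ Ω) := measurableSet_ball.diff hO.measurableSet
  have hbf := block_fin hh z
  have hs : (Ω ∩ block h z) ∪ (ball x h \ Ω) ⊆ block h z :=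
    union_subset inter_subset_right (sdiff_subset.trans (ball_sub_block hh hx))
  have h1 : volume (Ω ∩ block h z) ≠ ⊤ :=
    measure_ne_top_of_subset (subset_union_left.trans hs : Ω ∩ block h z ⊆ block h z) hbf
  have h2 : volume (ball x h \ Ω) ≠ ⊤ :=
    measure_ne_top_of_subset (subset_union_right.trans hs : ball x h \ Ω ⊆ block h z) hbf
  have hdis : Disjoint (Ω ∩ block h z) (ball x h \ Ω) := by
    rw [Set.disjoint_left]; rintro y ⟨a, _⟩ ⟨_, b⟩; exact b a
  have h3 := measureReal_mono hs hbf
  rw [measureReal_union hdis hm h1 h2, block_volr hh] at h3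
  have h4 : c * h ^ 2 ≤ volume.real (ball x h \ Ω) := (ENNReal.ofReal_le_iff_le_toReal h2).1 hd
  rw [avg, div_le_iff₀ (by positivity)]
  nlinarith

lemma gain_lower {Ω : Set E2} (hO : IsOpen Ω) {h s t : ℝ} (hh : 0 < h) (hs0 : 0 ≤ s) (hs1 : s < 1)
    {Z : Finset (ℤ × ℤ)} (hZ : ∀ z, z ∈ Z ↔ s < avg Ω h z)
    (hTf : volume (thickening (4 * h) (frontier Ω)) ≤ ENNReal.ofReal t) (ht : 0 ≤ t) (i : Fin 2) (N : ℕ) :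
    volume.real (gainSet Ω (((N:ℝ) * h) • EuclideanSpace.single i (1:ℝ))) ≤
      h ^ 2 * (N * (Z.filter fun z => z - dI i ∉ Z).card) + 2 * t := by
  set T := thickening (4 * h) (frontier Ω) with hTd
  set v : E2 := ((N:ℝ) * h) • EuclideanSpace.single i (1:ℝ) with hv
  set J := (Z.filter fun z => z - N • dI i ∉ Z).image (fun z => z - N • dI i) with hJ
  have hTfin : volume T ≠ ⊤ := (hTf.trans_lt ENNReal.ofReal_lt_top).ne
  have hTr : volume.real T ≤ t := ENNReal.toReal_le_of_le_ofReal ht hTf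
  have hT'r : volume.real ((· + v) ⁻¹' T) ≤ t := by
    rw [measureReal_def, measure_preimage_add_right]; exact hTr
  have hT'fin : volume ((· + v) ⁻¹' T) ≠ ⊤ := by rwa [measure_preimage_add_right]
  have hsub : gainSet Ω v ⊆ (⋃ w ∈ J, cell h w) ∪ (T ∪ (· + v) ⁻¹' T) := by
    rintro x ⟨hx1, hx2⟩
    by_cases hxT : x ∈ T
    · exact Or.inr (Or.inl hxT)
    by_cases hxT' : x + v ∈ T
    · exact Or.inr (Or.inr hxT')
    left
    have a0 := avg_zero hO hh hx1 hxT
    have a1 := avg_one hO hh hx2 hxT'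
    rw [hv, idx_shift hh] at a1
    simp only [mem_iUnion]
    refine ⟨idx h x, ?_, rfl⟩
    rw [hJ, Finset.mem_image]
    refine ⟨idx h x + N • dI i, ?_, by abel⟩
    rw [Finset.mem_filter, hZ, hZ, add_sub_cancel_right, a0, a1]
    exact ⟨hs1, by linarith⟩
  have hUf : volume (⋃ w ∈ J, cell h w) ≠ ⊤ := by
    refine ((measure_biUnion_finset_le _ _).trans_lt ?_).ne
    refine ENNReal.sum_lt_top.2 fun w _ => ?_
    rw [cell_vol hh]; exact ENNReal.ofReal_lt_top
  have h1 := measureReal_mono hsub (measure_union_ne_top hUf (measure_union_ne_top hTfin hT'fin))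
  have h2 : volume.real (⋃ w ∈ J, cell h w) ≤ h ^ 2 * J.card := by
    refine cells_le hh J ?_
    intro x hx; simp only [mem_iUnion] at hx
    obtain ⟨w, hw, rfl⟩ := hx; exact hw
  have h3 : (J.card : ℝ) ≤ N * (Z.filter fun z => z - dI i ∉ Z).card := by
    have : J.card ≤ N * (Z.filter fun z => z - dI i ∉ Z).card :=
      (Finset.card_image_le (s := Z.filter fun z => z - N • dI i ∉ Z)).trans (card_shift_le (dI i) Z N)
    exact_mod_cast this
  have h4 := measureReal_union_le (μ := volume) (⋃ w ∈ J, cell h w) (T ∪ (· + v) ⁻¹' T)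
  have h5 := measureReal_union_le (μ := volume) T ((· + v) ⁻¹' T)
  have h6 := mul_le_mul_of_nonneg_left h3 (sq_nonneg h)
  linarith

lemma vol_lower {Ω : Set E2} (hO : IsOpen Ω) {h s t : ℝ} (hh : 0 < h) (hs1 : s < 1)
    {Z : Finset (ℤ × ℤ)} (hZ : ∀ z, z ∈ Z ↔ s < avg Ω h z)
    (hTf : volume (thickening (4 * h) (frontier Ω)) ≤ ENNReal.ofReal t) (ht : 0 ≤ t) :
    volume.real Ω ≤ h ^ 2 * Z.card + t := by
  set T := thickening (4 * h) (frontier Ω) with hTd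
  have hTfin : volume T ≠ ⊤ := (hTf.trans_lt ENNReal.ofReal_lt_top).ne
  have hTr : volume.real T ≤ t := ENNReal.toReal_le_of_le_ofReal ht hTf
  have hsub : Ω ⊆ (⋃ w ∈ Z, cell h w) ∪ T := by
    intro x hx
    by_cases hxT : x ∈ T
    · exact Or.inr hxT
    left
    simp only [mem_iUnion]
    exact ⟨idx h x, by rw [hZ, avg_one hO hh hx hxT]; exact hs1, rfl⟩
  have hUf : volume (⋃ w ∈ Z, cell h w) ≠ ⊤ := by
    refine ((measure_biUnion_finset_le _ _).trans_lt ?_).ne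
    refine ENNReal.sum_lt_top.2 fun w _ => ?_
    rw [cell_vol hh]; exact ENNReal.ofReal_lt_top
  have h1 := measureReal_mono hsub (measure_union_ne_top hUf hTfin)
  have h2 : volume.real (⋃ w ∈ Z, cell h w) ≤ h ^ 2 * Z.card := by
    refine cells_le hh Z ?_
    intro x hx; simp only [mem_iUnion] at hx
    obtain ⟨w, hw, rfl⟩ := hx; exact hw
  have h4 := measureReal_union_le (μ := volume) (⋃ w ∈ Z, cell h w) T
  linarith

lemma sub_dI0 (z : ℤ × ℤ) : z - dI 0 = (z.1 - 1, z.2) := by ext <;> simp [dI]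
lemma sub_dI1 (z : ℤ × ℤ) : z - dI 1 = (z.1, z.2 - 1) := by ext <;> simp [dI]

lemma idx_bound {h ρ : ℝ} (hh : 0 < h) {x : E2} (hx : ‖x‖ < ρ) :
    |(idx h x).1| + 4 ≤ (⌈ρ / h⌉₊ + 10 : ℕ) ∧ |(idx h x).2| + 4 ≤ (⌈ρ / h⌉₊ + 10 : ℕ) := by
  have key : ∀ (a : ℤ) (t : ℝ), |t| < ρ → (a:ℝ) * h ≤ t → t < (a + 1) * h → |a| + 4 ≤ (⌈ρ / h⌉₊ + 10 : ℕ) := by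
    intro a t ht h1 h2
    rw [abs_lt] at ht
    have hc := Nat.le_ceil (ρ / h)
    have e1 : (a:ℝ) < ρ / h := by rw [lt_div_iff₀ hh]; linarith
    have e2 : -(ρ / h) < (a:ℝ) + 1 := by
      rw [← neg_div, div_lt_iff₀ hh]; linarith
    have e3 : (a:ℝ) < ((⌈ρ / h⌉₊ : ℤ):ℝ) := by push_cast; linarith
    have e4 : ((-(⌈ρ / h⌉₊ : ℤ) : ℤ):ℝ) < ((a + 1 : ℤ):ℝ) := by push_cast; linarith
    have e3 : a < (⌈ρ / h⌉₊ : ℤ) := by exact_mod_cast e3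
    have e4 : -(⌈ρ / h⌉₊ : ℤ) < a + 1 := by exact_mod_cast e4
    push_cast
    have : |a| ≤ (⌈ρ / h⌉₊ : ℤ) + 1 := by rw [abs_le]; omega
    omega
  obtain ⟨⟨a, b⟩, c, d⟩ := (idx_eq hh (x := x)).1 rfl
  exact ⟨key _ _ ((coord_le x 0).trans_lt hx) a b, key _ _ ((coord_le x 1).trans_lt hx) c d⟩

set_option maxHeartbeats 1000000 in
lemma select {Ω : Set E2} (hO : IsOpen Ω) (hb : IsBounded Ω) (hL : IsLipschitzDomain Ω) {η : ℝ} (hη : 0 < η) :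
    ∃ h, 0 < h ∧ h < η ∧ ∃ (n : ℕ) (Z : Finset (ℤ × ℤ)), 0 < n ∧
      (∀ x ∈ Ω, |(idx h x).1| + 4 ≤ n ∧ |(idx h x).2| + 4 ≤ n) ∧
      (∀ z ∈ Z, |z.1| + 2 ≤ n ∧ |z.2| + 2 ≤ n) ∧
      (∀ z ∈ Z, ∀ x ∈ ccell h z, x ∈ Ω) ∧
      volume.real Ω ≤ h ^ 2 * Z.card + η ∧
      h * (((Z.filter fun z => (z.1 - 1, z.2) ∉ Z).card : ℝ) + ((Z.filter fun z => (z.1, z.2 - 1) ∉ Z).card : ℝ)) ≤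
        perimeter Ω / √2 + η := by
  have hB := lip_bddAbove hO hb hL
  have hfin : volume Ω ≠ ⊤ := hb.measure_lt_top.ne
  obtain ⟨C, r0, hC, hr0, htube⟩ := tube_bound hO hb hL
  obtain ⟨c, r1, hc, hr1, hdens⟩ := dens_bound hO hb hL
  obtain ⟨ρ, hρ⟩ := hb.subset_ball 0
  let g : ℝ → ℝ := fun H => volume.real (gainSet Ω (H • EuclideanSpace.single 0 (1:ℝ))) +
    volume.real (gainSet Ω (H • EuclideanSpace.single 1 (1:ℝ)))
  have hg : ∀ H, 0 < H → g H / H ≤ perimeter Ω / √2 := by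
    intro H hH
    have := gain_le hO.measurableSet hfin hB hH.le
    rw [div_le_div_iff₀ hH (by positivity)]
    simp only [g]; linarith
  let S : Set ℝ := {r | ∃ H, 0 < H ∧ r = g H / H}
  have hSb : BddAbove S := ⟨perimeter Ω / √2, by rintro r ⟨H, hH, rfl⟩; exact hg H hH⟩
  have hSn : S.Nonempty := ⟨_, 1, one_pos, rfl⟩
  set V := sSup S with hV
  have hVP : V ≤ perimeter Ω / √2 := csSup_le hSn (by rintro r ⟨H, hH, rfl⟩; exact hg H hH)
  have hgV : ∀ H, 0 < H → g H ≤ V * H := by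
    intro H hH
    have : g H / H ≤ V := le_csSup hSb ⟨H, hH, rfl⟩
    rwa [div_le_iff₀ hH] at this
  set c' := min (c / 9) (1 / 2) with hc'
  have hc'0 : 0 < c' := lt_min (by positivity) (by norm_num)
  have hc'1 : c' ≤ 1 / 2 := min_le_right _ _
  have hc'2 : c' ≤ c / 9 := min_le_left _ _
  set δ := c' * η with hδ
  have hδ0 : 0 < δ := by positivity
  obtain ⟨_, ⟨H, hH, rfl⟩, hHV⟩ := exists_lt_of_lt_csSup hSn (show V - δ / 2 < sSup S by rw [← hV]; linarith)
  rw [lt_div_iff₀ hH] at hHV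
  set ε := min (min η r1) (min (r0 / 4) (min (η / (4 * C + 1)) (δ * H / (2 * (16 * C + 1))))) with hε
  have hε0 : 0 < ε := by
    refine lt_min (lt_min hη hr1) (lt_min (by positivity) (lt_min (by positivity) (by positivity)))
  obtain ⟨N, hN⟩ := exists_nat_gt (H / ε)
  have hN0 : (0:ℝ) < N := lt_trans (by positivity) hN
  set h := H / N with hh_def
  have hh : 0 < h := by positivity
  have hhε : h < ε := by
    rw [hh_def, div_lt_iff₀ hN0]; rw [div_lt_iff₀ hε0] at hN; linarith
  have hNh : (N:ℝ) * h = H := by rw [hh_def]; field_simp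
  have k1 : h < η := hhε.trans_le ((min_le_left _ _).trans (min_le_left _ _))
  have k2 : h < r1 := hhε.trans_le ((min_le_left _ _).trans (min_le_right _ _))
  have k3 : h < r0 / 4 := hhε.trans_le ((min_le_right _ _).trans (min_le_left _ _))
  have k4 : h < η / (4 * C + 1) := hhε.trans_le ((min_le_right _ _).trans ((min_le_right _ _).trans (min_le_left _ _)))
  have k5 : h < δ * H / (2 * (16 * C + 1)) :=
    hhε.trans_le ((min_le_right _ _).trans ((min_le_right _ _).trans (min_le_right _ _)))
  rw [lt_div_iff₀ (by positivity)] at k4 k5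
  have hT := htube (4 * h) (by positivity) (by linarith)
  have hCh : 0 ≤ C * (4 * h) := by positivity
  set n := ⌈ρ / h⌉₊ + 10 with hn
  have hidx : ∀ x ∈ Ω, |(idx h x).1| + 4 ≤ n ∧ |(idx h x).2| + 4 ≤ n := by
    intro x hx
    exact idx_bound hh (by simpa using hρ hx)
  have havg : ∀ z, 0 < avg Ω h z → |z.1| + 2 ≤ n ∧ |z.2| + 2 ≤ n := by
    intro z hz
    have : (Ω ∩ block h z).Nonempty := by
      by_contra hne
      rw [Set.not_nonempty_iff_eq_empty] at hne
      rw [avg, hne] at hz; simp at hz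
    obtain ⟨x, hx1, hx2⟩ := this
    simp only [block, Set.mem_ofPred_eq, mem_nbr] at hx2
    have h3 := hidx x hx1
    have h4 := abs_le.1 (show |(idx h x).1| ≤ n - 4 by omega)
    have h5 := abs_le.1 (show |(idx h x).2| ≤ n - 4 by omega)
    have h6 : |z.1| ≤ n - 2 := abs_le.2 (by omega)
    have h7 : |z.2| ≤ n - 2 := abs_le.2 (by omega)
    omega
  set I := cellBox (-(n:ℤ)) (2 * n) with hI
  let Z : ℝ → Finset (ℤ × ℤ) := fun s => I.filter fun z => s < avg Ω h z
  have hZ : ∀ s, 0 ≤ s → ∀ z, z ∈ Z s ↔ s < avg Ω h z := by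
    intro s hs z
    simp only [Z, Finset.mem_filter, and_iff_right_iff_imp]
    intro hz
    have h1 := havg z (by linarith)
    have h4 := abs_le.1 (show |z.1| ≤ n - 2 by omega)
    have h5 := abs_le.1 (show |z.2| ≤ n - 2 by omega)
    rw [hI, mem_cellBox]
    push_cast
    omega
  have hfil : ∀ s, 0 ≤ s → ∀ i : Fin 2, (I.filter fun z => avg Ω h (z - dI i) ≤ s ∧ s < avg Ω h z) =
      (Z s).filter fun z => z - dI i ∉ Z s := by
    intro s hs i
    ext z
    have hz : z ∈ Z s ↔ z ∈ I ∧ s < avg Ω h z := Finset.mem_filter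
    rw [Finset.mem_filter, Finset.mem_filter, hZ s hs (z - dI i), not_lt, hz]
    exact ⟨fun u => ⟨⟨u.1, u.2.2⟩, u.2.1⟩, fun u => ⟨u.1.1, u.2, u.1.2⟩⟩
  have hsel := coarea_select I (fun z => avg Ω h (z - dI 0)) (fun z => avg Ω h (z - dI 1)) (fun z => avg Ω h z)
    (A := V / h) (B := (V + η) / h) (L := (V - δ) / h) (c := c') hc'0 (by linarith) ?_ ?_ ?_
  · obtain ⟨s, hs1, hs2, hs3⟩ := hsel
    have hs0 : 0 ≤ s := by linarith
    refine ⟨h, hh, k1, n, Z s, by omega, hidx, ?_, ?_, ?_, ?_⟩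
    · intro z hz
      rw [hZ s hs0] at hz
      exact havg z (by linarith)
    · intro z hz x hx
      by_contra hxn
      rw [hZ s hs0] at hz
      have := avg_dens hO hh hx (hdens x hxn h hh k2)
      linarith
    · have := vol_lower hO hh hs2 (hZ s hs0) hT hCh
      nlinarith
    · rw [hfil s hs0, hfil s hs0] at hs3
      simp only [sub_dI0, sub_dI1] at hs3
      rw [le_div_iff₀ hh] at hs3
      linarith
  · rw [Finset.sum_add_distrib]
    have a0 := avg_upper hO.measurableSet hfin hh I 0
    have a1 := avg_upper hO.measurableSet hfin hh I 1
    refine (add_le_add a0 a1).trans ?_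
    rw [← add_div, div_le_div_iff₀ (by positivity) hh]
    have := hgV h hh
    simp only [g] at this
    nlinarith
  · intro s hs0 hs1
    rw [hfil s hs0.le, hfil s hs0.le]
    have a0 := gain_lower hO hh hs0.le hs1 (hZ s hs0.le) hT hCh 0 N
    have a1 := gain_lower hO hh hs0.le hs1 (hZ s hs0.le) hT hCh 1 N
    rw [hNh] at a0 a1
    simp only [g] at hHV
    rw [div_le_iff₀ hh]
    set p0 : ℝ := (((Z s).filter fun z => z - dI 0 ∉ Z s).card : ℝ)
    set p1 : ℝ := (((Z s).filter fun z => z - dI 1 ∉ Z s).card : ℝ)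
    have e : h ^ 2 * (N * p0) + h ^ 2 * (N * p1) = H * ((p0 + p1) * h) := by rw [← hNh]; ring
    have : H * (V - δ) < H * ((p0 + p1) * h) := by nlinarith
    exact (lt_of_mul_lt_mul_left this hH.le).le
  · have e : c' * ((V + η) / h) + (1 - c') * ((V - δ) / h) = (V + c' ^ 2 * η) / h := by
      rw [hδ]; field_simp; ring
    rw [e]
    exact div_lt_div_of_pos_right (by nlinarith [mul_pos (pow_pos hc'0 2) hη]) hh

lemma step_card {S D P : Finset (ℤ × ℤ)} {m : ℕ} (f : ℕ → ℤ × ℤ)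
    (h : ∀ z ∈ S, z ∉ D → (∃ i < m, f i = z) ∨ z ∈ P) : S.card ≤ D.card + (m + P.card) := by
  have hs : S ⊆ D ∪ ((Finset.range m).image f ∪ P) := by
    intro z hz
    by_cases hzD : z ∈ D
    · exact Finset.mem_union_left _ hzD
    · refine Finset.mem_union_right _ ?_
      rcases h z hz hzD with ⟨i, hi, rfl⟩ | hp
      · exact Finset.mem_union_left _ (Finset.mem_image.2 ⟨i, Finset.mem_range.2 hi, rfl⟩)
      · exact Finset.mem_union_right _ hp
  refine (Finset.card_le_card hs).trans ((Finset.card_union_le _ _).trans ?_)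
  refine Nat.add_le_add_left ((Finset.card_union_le _ _).trans ?_) _
  refine Nat.add_le_add_right (Finset.card_image_le.trans ?_) _
  simp

lemma disc {Ω : Set E2} (hO : IsOpen Ω) (hb : IsBounded Ω) (hL : IsLipschitzDomain Ω) {k : ℕ}
    (hk : nBddCompLe Ωᶜ k) {η : ℝ} (hη : 0 < η) :
    ∃ h, 0 < h ∧ h < η ∧ ∃ (lo : ℤ) (m : ℕ) (D : Finset (ℤ × ℤ)) (p q : ℕ), 0 < m ∧ D ⊆ cellBox lo m ∧
      HasReps D (k + 1) ∧ (stepH D).card ≤ D.card + (m + p) ∧ (stepV D).card ≤ D.card + (m + q) ∧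
      (∀ z ∈ cellBox lo m, (z.1 = lo ∨ z.1 = lo + m - 1 ∨ z.2 = lo ∨ z.2 = lo + m - 1) → z ∈ D) ∧
      (∀ z ∈ cellBox lo m \ D, ∀ x ∈ ccell h z, x ∈ Ω) ∧
      volume.real Ω ≤ h ^ 2 * ((cellBox lo m \ D).card : ℝ) + η ∧
      volume.real Ω ≤ h ^ 2 * ((p:ℝ) * q) + η ∧
      h * ((p:ℝ) + q) ≤ perimeter Ω / √2 + η := by
  obtain ⟨h, hh, hhη, n, Z, hn, hidx, hZn, hZΩ, hvol, hper⟩ := select hO hb hL hη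
  obtain ⟨lo, hlo⟩ : ∃ lo : ℤ, lo = -(n:ℤ) := ⟨_, rfl⟩
  obtain ⟨m, hm⟩ : ∃ m : ℕ, m = 2 * n := ⟨_, rfl⟩
  obtain ⟨W, hmW⟩ : ∃ W : Finset (ℤ × ℤ), ∀ z, z ∈ W ↔ z ∈ cellBox lo m ∧ z ∉ Z :=
    ⟨cellBox lo m \ Z, fun z => Finset.mem_sdiff⟩
  obtain ⟨D, hmD⟩ : ∃ D : Finset (ℤ × ℤ), ∀ z, z ∈ D ↔ z ∈ W ∧ ∃ z0 ∈ W, (∃ x ∈ Ωᶜ, x ∈ ccell h z0) ∧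
      Relation.ReflTransGen (cellRel W) z0 z :=
    by
      classical
      exact ⟨W.filter (fun z => ∃ z0 ∈ W, (∃ x ∈ Ωᶜ, x ∈ ccell h z0) ∧ Relation.ReflTransGen (cellRel W) z0 z),
        fun z => Finset.mem_filter⟩
  have hDW : D ⊆ W := fun z hz => ((hmD z).1 hz).1
  have hDB : D ⊆ cellBox lo m := fun z hz => ((hmW z).1 (hDW hz)).1
  have hmeet : ∀ z ∈ cellBox lo m, (∃ x ∈ Ωᶜ, x ∈ ccell h z) → z ∈ D := by
    rintro z hz ⟨x, hx, hxz⟩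
    have hzW : z ∈ W := (hmW z).2 ⟨hz, fun hzZ => hx (hZΩ z hzZ x hxz)⟩
    exact (hmD z).2 ⟨hzW, z, hzW, ⟨x, hx, hxz⟩, Relation.ReflTransGen.refl⟩
  have hreach : ∀ z ∈ D, ∃ z0 ∈ D, (∃ x ∈ Ωᶜ, x ∈ ccell h z0) ∧ Relation.ReflTransGen (cellRel D) z0 z := by
    intro z hz
    obtain ⟨hzW, z0, hz0, hx, hp⟩ := (hmD z).1 hz
    refine ⟨z0, hmeet z0 ((hmW z0).1 hz0).1 hx, hx, ?_⟩
    clear hz hzW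
    induction hp with
    | refl => exact Relation.ReflTransGen.refl
    | tail h1 h2 ih =>
      refine ih.tail ⟨?_, ?_, h2.2.2⟩
      · exact (hmD _).2 ⟨h2.1, z0, hz0, hx, h1⟩
      · exact (hmD _).2 ⟨h2.2.1, z0, hz0, hx, h1.tail h2⟩
  have hbd : ∀ z ∈ cellBox lo m, (z.1 = lo ∨ z.1 = lo + m - 1 ∨ z.2 = lo ∨ z.2 = lo + m - 1) → z ∈ D := by
    intro z hz hzb
    have e : idx h (!₂[(z.1:ℝ) * h, (z.2:ℝ) * h]) = z := by
      rw [idx_eq hh]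
      simp only [Matrix.cons_val_zero, Matrix.cons_val_one, le_refl, true_and]
      constructor <;> nlinarith
    refine hmeet z hz ⟨!₂[(z.1:ℝ) * h, (z.2:ℝ) * h], fun hx => ?_, ?_⟩
    · have := hidx _ hx
      rw [e] at this
      have h1 := abs_le.1 (show |z.1| ≤ n - 4 by omega)
      have h2 := abs_le.1 (show |z.2| ≤ n - 4 by omega)
      omega
    · have := mem_ccell_idx hh (!₂[(z.1:ℝ) * h, (z.2:ℝ) * h])
      rwa [e] at this
  have hadj : ∀ z w, w ∈ D → z ∈ cellBox lo m → z ∉ D → |w.1 - z.1| ≤ 1 → |w.2 - z.2| ≤ 1 → z ∈ Z ∧ w ∉ Z := by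
    intro z w hw hz hzD h1 h2
    refine ⟨?_, ((hmW w).1 (hDW hw)).2⟩
    by_contra hzZ
    apply hzD
    have hzW : z ∈ W := (hmW z).2 ⟨hz, hzZ⟩
    obtain ⟨hwW, z0, hz0, hx, hp⟩ := (hmD w).1 hw
    exact (hmD z).2 ⟨hzW, z0, hz0, hx, hp.tail ⟨hwW, hzW, h1, h2⟩⟩
  have hZsub : Z ⊆ cellBox lo m \ D := by
    intro z hz
    have h1 := hZn z hz
    have h4 := abs_le.1 (show |z.1| ≤ n - 2 by omega)
    have h5 := abs_le.1 (show |z.2| ≤ n - 2 by omega)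
    refine Finset.mem_sdiff.2 ⟨?_, fun hzD => ((hmW z).1 (hDW hzD)).2 hz⟩
    rw [mem_cellBox]; push_cast [hm]; omega
  have hm0 : 0 < m := by omega
  have hreps := reps hh hm0 hDB hmeet hreach hbd hk
  have hends := card_le_mul_ends Z
  obtain ⟨P1, hP1⟩ : ∃ A : Finset (ℤ × ℤ), A = Z.filter fun z => (z.1 - 1, z.2) ∉ Z := ⟨_, rfl⟩
  obtain ⟨P2, hP2⟩ : ∃ A : Finset (ℤ × ℤ), A = Z.filter fun z => (z.1, z.2 - 1) ∉ Z := ⟨_, rfl⟩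
  rw [← hP1, ← hP2] at hper hends
  refine ⟨h, hh, hhη, lo, m, D, P1.card, P2.card, hm0, hDB, hreps, ?_, ?_, hbd, ?_, ?_, ?_, hper⟩
  · refine step_card (fun i => (lo + m, lo + i)) ?_
    intro z hz hzD
    rcases mem_stepH.1 hz with hz | hz
    · exact absurd hz hzD
    by_cases hzB : z ∈ cellBox lo m
    · right
      obtain ⟨a, b⟩ := hadj z _ hz hzB hzD (by simp) (by simp)
      rw [hP1]
      exact Finset.mem_filter.2 ⟨a, b⟩
    · left
      have h1 := hDB hz
      rw [mem_cellBox] at h1 hzB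
      simp only at h1
      refine ⟨(z.2 - lo).toNat, by omega, ?_⟩
      ext <;> simp only <;> omega
  · refine step_card (fun i => (lo + i, lo + m)) ?_
    intro z hz hzD
    rcases mem_stepV.1 hz with hz | hz
    · exact absurd hz hzD
    by_cases hzB : z ∈ cellBox lo m
    · right
      obtain ⟨a, b⟩ := hadj z _ hz hzB hzD (by simp) (by simp)
      rw [hP2]
      exact Finset.mem_filter.2 ⟨a, b⟩
    · left
      have h1 := hDB hz
      rw [mem_cellBox] at h1 hzB
      simp only at h1
      refine ⟨(z.1 - lo).toNat, by omega, ?_⟩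
      ext <;> simp only <;> omega
  · intro z hz x hx
    obtain ⟨a, b⟩ := Finset.mem_sdiff.1 hz
    by_contra hxn
    exact b (hmeet z a ⟨x, hxn, hx⟩)
  · have : (Z.card : ℝ) ≤ ((cellBox lo m \ D).card : ℝ) := by exact_mod_cast Finset.card_le_card hZsub
    have := mul_le_mul_of_nonneg_left this (sq_nonneg h)
    linarith
  · have : (Z.card : ℝ) ≤ (P1.card : ℝ) * (P2.card : ℝ) := by exact_mod_cast hends
    have := mul_le_mul_of_nonneg_left this (sq_nonneg h)
    linarith

lemma iso {Ω : Set E2} (hO : IsOpen Ω) (hb : IsBounded Ω) (hL : IsLipschitzDomain Ω) {k : ℕ}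
    (hk : nBddCompLe Ωᶜ k) : 8 * volume.real Ω ≤ (perimeter Ω) ^ 2 := by
  have key : ∀ η : ℝ, 0 < η → volume.real Ω ≤ (perimeter Ω / √2 + η) ^ 2 / 4 + η := by
    intro η hη
    obtain ⟨h, hh, -, lo, m, D, p, q, -, -, -, -, -, -, -, -, h1, h2⟩ := disc hO hb hL hk hη
    have h3 : 0 ≤ h * ((p:ℝ) + q) := by positivity
    have h4 := pow_le_pow_left₀ h3 h2 2
    nlinarith [sq_nonneg (h * ((p:ℝ) - q))]
  have ht : Tendsto (fun η : ℝ => (perimeter Ω / √2 + η) ^ 2 / 4 + η) (𝓝[>] 0)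
      (𝓝 ((perimeter Ω / √2 + 0) ^ 2 / 4 + 0)) := by
    apply tendsto_nhdsWithin_of_tendsto_nhds
    exact Continuous.tendsto (by fun_prop) 0
  have := ge_of_tendsto ht (eventually_nhdsWithin_of_forall fun η hη => key η hη)
  rw [add_zero, add_zero, div_pow, Real.sq_sqrt (by norm_num)] at this
  linarith

lemma collar {Ω : Set E2} (hO : IsOpen Ω) (hb : IsBounded Ω) (hL : IsLipschitzDomain Ω) {k : ℕ}
    (hk : nBddCompLe Ωᶜ k) {t : ℝ} (ht : 0 < t) :
    volume.real {x ∈ Ω | infDist x Ωᶜ < t} ≤ √2 * perimeter Ω * t + 4 * k * t ^ 2 := by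
  have hfin : volume Ω ≠ ⊤ := hb.measure_lt_top.ne
  have hKne : (Ωᶜ).Nonempty := by
    by_contra hne
    rw [Set.not_nonempty_iff_eq_empty, Set.compl_empty_iff] at hne
    rw [hne] at hfin
    exact hfin (measure_univ_of_isAddLeftInvariant _)
  set S := {x ∈ Ω | infDist x Ωᶜ < t} with hS
  have key : ∀ η : ℝ, 0 < η → volume.real S ≤
      2 * ((t + η) * (perimeter Ω / √2 + η)) + 4 * k * (t + η) ^ 2 + η := by
    intro η hη
    obtain ⟨h, hh, hhη, lo, m, D, p, q, hm, hDB, hrep, hp, hq, hbd, hcell, hvol, -, hper⟩ := disc hO hb hL hk hη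
    set R := ⌈t / h⌉₊ with hR
    have hR1 : t ≤ R * h := by
      have := Nat.le_ceil (t / h); rwa [div_le_iff₀ hh] at this
    have hR2 : R * h ≤ t + η := by
      have := (Nat.ceil_lt_add_one (show 0 ≤ t / h by positivity)).le
      have := mul_le_mul_of_nonneg_right this hh.le
      rw [add_mul, div_mul_cancel₀ _ hh.ne'] at this
      linarith
    obtain ⟨G, hG, hGc⟩ := erode_card hm hDB hrep hp hq hbd R
    set U := {x : E2 | idx h x ∈ G} with hU
    have hUm : MeasurableSet U := idx_meas h (Finset.measurableSet G)
    have hUv : volume.real U = h ^ 2 * G.card := by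
      have := cells_real MeasurableSet.univ hh G
      simp only [Set.univ_inter, cell_volr hh, Finset.sum_const] at this
      rw [hU, this, nsmul_eq_mul, mul_comm]
    have hUΩ : U ⊆ Ω := by
      intro x hx
      refine hcell (idx h x) ?_ x (mem_ccell_idx hh x)
      have := hG _ hx 0 0 (by simp) (by simp)
      simpa using this
    have hUS : Disjoint S U := by
      rw [Set.disjoint_left]
      rintro x ⟨hx1, hx2⟩ hx3
      refine absurd hx2 (not_lt.2 ((le_infDist hKne).2 fun y hy => ?_))
      by_contra hlt
      push Not at hlt
      apply hy
      rw [dist_comm, dist_eq_norm] at hlt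
      have g1 := (coord_le (y - x) 0).trans_lt hlt
      have g2 := (coord_le (y - x) 1).trans_lt hlt
      rw [PiLp.sub_apply, abs_lt] at g1 g2
      obtain ⟨⟨a, b⟩, c, d⟩ := (idx_eq hh (x := x)).1 rfl
      obtain ⟨⟨a', b'⟩, c', d'⟩ := (idx_eq hh (x := y)).1 rfl
      have q1 : ((idx h x).1:ℝ) < (idx h y).1 + 1 + R := lt_of_mul_lt_mul_right (by linarith : _ * h < _ * h) hh.le
      have q2 : ((idx h y).1:ℝ) < (idx h x).1 + 1 + R := lt_of_mul_lt_mul_right (by linarith : _ * h < _ * h) hh.le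
      have q3 : ((idx h x).2:ℝ) < (idx h y).2 + 1 + R := lt_of_mul_lt_mul_right (by linarith : _ * h < _ * h) hh.le
      have q4 : ((idx h y).2:ℝ) < (idx h x).2 + 1 + R := lt_of_mul_lt_mul_right (by linarith : _ * h < _ * h) hh.le
      have q1 : (idx h x).1 < (idx h y).1 + 1 + R := by exact_mod_cast q1
      have q2 : (idx h y).1 < (idx h x).1 + 1 + R := by exact_mod_cast q2
      have q3 : (idx h x).2 < (idx h y).2 + 1 + R := by exact_mod_cast q3
      have q4 : (idx h y).2 < (idx h x).2 + 1 + R := by exact_mod_cast q4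
      have := hG _ hx3 ((idx h y).1 - (idx h x).1) ((idx h y).2 - (idx h x).2)
        (abs_le.2 (by omega)) (abs_le.2 (by omega))
      rw [add_sub_cancel, add_sub_cancel] at this
      exact hcell _ this y (mem_ccell_idx hh y)
    have hsum : volume.real S + volume.real U ≤ volume.real Ω := by
      rw [← measureReal_union hUS hUm (measure_ne_top_of_subset (sep_subset _ _ : S ⊆ Ω) hfin)
        (measure_ne_top_of_subset hUΩ hfin)]
      exact measureReal_mono (union_subset (sep_subset _ _) hUΩ) hfin
    have hGc' : ((cellBox lo m \ D).card : ℝ) ≤ G.card + 2 * R * ((p:ℝ) + q) + 4 * k * (R:ℝ) ^ 2 := by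
      exact_mod_cast hGc
    have e1 := mul_le_mul_of_nonneg_left hGc' (sq_nonneg h)
    have e2 : (R * h) * (h * ((p:ℝ) + q)) ≤ (t + η) * (perimeter Ω / √2 + η) :=
      mul_le_mul hR2 hper (by positivity) (by positivity)
    have e3 : ((R:ℝ) * h) ^ 2 ≤ (t + η) ^ 2 := pow_le_pow_left₀ (by positivity) hR2 2
    have e4 := mul_le_mul_of_nonneg_left e3 (show (0:ℝ) ≤ 4 * k by positivity)
    nlinarith
  have hlim : Tendsto (fun η : ℝ => 2 * ((t + η) * (perimeter Ω / √2 + η)) + 4 * k * (t + η) ^ 2 + η) (𝓝[>] 0)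
      (𝓝 (2 * ((t + 0) * (perimeter Ω / √2 + 0)) + 4 * k * (t + 0) ^ 2 + 0)) := by
    apply tendsto_nhdsWithin_of_tendsto_nhds
    exact Continuous.tendsto (by fun_prop) 0
  have := ge_of_tendsto hlim (eventually_nhdsWithin_of_forall fun η hη => key η hη)
  have e : perimeter Ω / √2 = perimeter Ω * √2 / 2 := by
    rw [div_eq_div_iff (by positivity) (by norm_num), mul_assoc, Real.mul_self_sqrt (by norm_num)]
  rw [e] at this
  linarith

/-- The identity `F_q = F_{1/2}·(T/|Ω|²)^{q-1/2}` and the resulting lower bound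
`F_q ≥ (8π)^{1/2-q}(√3 k)⁻¹` for Lipschitz sets in `𝒜ₖ`, `k > 1`, `q ≤ 1/2`. -/
theorem Fq_identity_and_bound (q : ℝ) (hq : 0 < q) (Ω : Set E2)
    (hO : IsOpen Ω) (hb : IsBounded Ω) (hvol : (volume Ω).toReal > 0)
    (hT : 0 < torsion Ω) :
    Fq q Ω = Fq (1/2) Ω * (torsion Ω / (volume Ω).toReal ^ 2) ^ (q - 1/2) ∧
    (∀ k : ℕ, 1 < k → q ≤ 1/2 → IsLipschitzDomain Ω → memA k Ω →
      Fq q Ω ≥ (8 * Real.pi) ^ ((1:ℝ)/2 - q) / (Real.sqrt 3 * (k : ℝ))) := by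
  refine ⟨Fq_identity q _ _ _ hT hvol, ?_⟩
  intro k hk hq2 hL hA
  have hB := lip_bddAbove hO hb hL
  have hP0 : 0 ≤ perimeter Ω := by
    have h1 := gain_le hO.measurableSet hb.measure_lt_top.ne hB (zero_le_one (α := ℝ))
    rw [mul_one] at h1
    exact le_trans (by positivity) h1
  exact final_bound hO hb hvol hT hq hq2 hk hP0 (iso hO hb hL hA.2.2.2)
    fun t ht => collar hO hb hL hA.2.2.2 ht
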